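/- arXiv:1811.04619 — 9 statements merged into one kernel-verified Lean document; each statement's English description precedes it below -/
import Mathlib

section
/- Fix λ > 0 and c ≥ 0, and set a_{λ,c} = (1/√λ)·sinh(arsinh(√λ c) − (π/2)√λ) − c and b_{λ,c} = (1/√λ)·sinh(arsinh(√λ c) + (π/2)√λ) − c. Define ψ(y) = √((y+c)² + 1/λ) · tan( (1/√λ)·( arsinh(√λ (y+c)) − arsinh(√λ c) ) ). Then ψ(0) = 0, and for every y ∈ (a_{λ,c}, b_{λ,c}) the function ψ is differentiable at y with ψ'(y) = 1/√λ + ( √λ·ψ(y)² + λ(y+c)·ψ(y) ) / ( 1 + λ(y+c)² ). -/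
open Real Filter Set

/-- The explicit function `ψ` solves the first-order ODE satisfied by `γ'`, where `γ`
generates the translation-invariant vertical translator of the Heisenberg group. -/
theorem tilted_grim_reaper_ode
    (lam c : ℝ) (hlam : 0 < lam) (hc : 0 ≤ c) (A B : ℝ)
    (hA : A = (1 / Real.sqrt lam) *
      Real.sinh (Real.arsinh (Real.sqrt lam * c) - (Real.pi / 2) * Real.sqrt lam) - c)
    (hB : B = (1 / Real.sqrt lam) *
      Real.sinh (Real.arsinh (Real.sqrt lam * c) + (Real.pi / 2) * Real.sqrt lam) - c)
    (ψ : ℝ → ℝ)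
    (hψ : ∀ y : ℝ, ψ y = Real.sqrt ((y + c) ^ 2 + 1 / lam) *
      Real.tan ((1 / Real.sqrt lam) *
        (Real.arsinh (Real.sqrt lam * (y + c)) - Real.arsinh (Real.sqrt lam * c)))) :
    ψ 0 = 0 ∧
    ∀ y ∈ Set.Ioo A B,
      HasDerivAt ψ
        (1 / Real.sqrt lam +
          (Real.sqrt lam * (ψ y) ^ 2 + lam * (y + c) * ψ y) / (1 + lam * (y + c) ^ 2)) y := by
  obtain ⟨s, hs, rfl⟩ : ∃ s : ℝ, 0 < s ∧ lam = s ^ 2 :=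
    ⟨√lam, Real.sqrt_pos.2 hlam, (Real.sq_sqrt hlam.le).symm⟩
  simp only [Real.sqrt_sq hs.le] at hA hB hψ ⊢
  refine ⟨by simp [hψ], fun y hy => ?_⟩
  obtain ⟨hAy, hyB⟩ := hy
  have hlo : Real.arsinh (s * c) - Real.pi / 2 * s < Real.arsinh (s * (y + c)) := by
    rw [← Real.sinh_lt_sinh, Real.sinh_arsinh, ← div_lt_iff₀' hs, div_eq_inv_mul, ← one_div]
    linarith
  have hhi : Real.arsinh (s * (y + c)) < Real.arsinh (s * c) + Real.pi / 2 * s := by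
    rw [← Real.sinh_lt_sinh, Real.sinh_arsinh, ← lt_div_iff₀' hs, div_eq_inv_mul, ← one_div]
    linarith
  set θ : ℝ → ℝ := fun y => 1 / s * (Real.arsinh (s * (y + c)) - Real.arsinh (s * c)) with hθ
  have hcos : Real.cos (θ y) ≠ 0 := by
    refine (Real.cos_pos_of_mem_Ioo ⟨?_, ?_⟩).ne' <;> simp only [hθ, one_div_mul_eq_div]
    · rw [lt_div_iff₀ hs]; linarith
    · rw [div_lt_iff₀ hs]; linarith
  have hpos : 0 < (y + c) ^ 2 + 1 / s ^ 2 := by positivity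
  have hS_sq : √((y + c) ^ 2 + 1 / s ^ 2) ^ 2 = (y + c) ^ 2 + 1 / s ^ 2 := Real.sq_sqrt hpos.le
  have hS : 0 < √((y + c) ^ 2 + 1 / s ^ 2) := Real.sqrt_pos.2 hpos
  have hshift : HasDerivAt (fun y => y + c) 1 y := (hasDerivAt_id y).add_const c
  have hS_deriv := ((hshift.pow 2).add_const (1 / s ^ 2)).sqrt hpos.ne'
  have hθ_deriv : HasDerivAt θ _ y :=
    (((hshift.const_mul s).arsinh).sub_const (Real.arsinh (s * c))).const_mul (1 / s)
  have hroot : √(1 + (s * (y + c)) ^ 2) = s * √((y + c) ^ 2 + 1 / s ^ 2) := by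
    rw [Real.sqrt_eq_iff_mul_self_eq (by positivity) (by positivity)]
    have : s * s * √((y + c) ^ 2 + 1 / s ^ 2) ^ 2 = 1 + (s * (y + c)) ^ 2 := by
      rw [hS_sq]; field_simp; ring
    linarith
  have htan := (Real.hasDerivAt_tan hcos).comp y hθ_deriv
  have hψ_eq : ψ = fun y => √((y + c) ^ 2 + 1 / s ^ 2) * Real.tan (θ y) := funext hψ
  rw [hψ_eq]
  refine (hS_deriv.mul htan).congr_deriv ?_
  have hden : 1 + s ^ 2 * (y + c) ^ 2 = s ^ 2 * √((y + c) ^ 2 + 1 / s ^ 2) ^ 2 := by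
    rw [hS_sq]; field_simp; ring
  have hsec : 1 / Real.cos (θ y) ^ 2 = 1 + Real.tan (θ y) ^ 2 := by
    rw [one_div, ← Real.inv_one_add_tan_sq hcos, inv_inv]
  simp only [hroot, hden, hsec, Function.comp_apply, Pi.pow_apply, smul_eq_mul]
  field_simp
  ring
end

section
/- Fix λ > 0 and c ≥ 0, and set a_{λ,c} = (1/√λ)·sinh(arsinh(√λ c) − (π/2)√λ) − c and b_{λ,c} = (1/√λ)·sinh(arsinh(√λ c) + (π/2)√λ) − c. Define ψ(y) = √((y+c)² + 1/λ) · tan( (1/√λ)·( arsinh(√λ (y+c)) − arsinh(√λ c) ) ). Then for every y ∈ (a_{λ,c}, b_{λ,c}) with y ≠ 0 one has y·ψ(y) > 0. Consequently any antiderivative γ of ψ on (a_{λ,c}, b_{λ,c}) is strictly decreasing on (a_{λ,c}, 0) and strictly increasing on (0, b_{λ,c}), hence has a global minimum at y = 0. -/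
open Real Set

/-- `y·ψ(y) > 0` for `y ≠ 0`, hence any antiderivative of `ψ` is strictly decreasing on
`(a, 0]`, strictly increasing on `[0, b)`, and has a global minimum at `0`. -/
theorem grim_reaper_monotonicity
    (lam c : ℝ) (hlam : 0 < lam) (hc : 0 ≤ c) (A B : ℝ)
    (hA : A = (1 / Real.sqrt lam) *
      Real.sinh (Real.arsinh (Real.sqrt lam * c) - (Real.pi / 2) * Real.sqrt lam) - c)
    (hB : B = (1 / Real.sqrt lam) *
      Real.sinh (Real.arsinh (Real.sqrt lam * c) + (Real.pi / 2) * Real.sqrt lam) - c)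
    (ψ : ℝ → ℝ)
    (hψ : ∀ y : ℝ, ψ y = Real.sqrt ((y + c) ^ 2 + 1 / lam) *
      Real.tan ((1 / Real.sqrt lam) *
        (Real.arsinh (Real.sqrt lam * (y + c)) - Real.arsinh (Real.sqrt lam * c)))) :
    (∀ y ∈ Set.Ioo A B, y ≠ 0 → 0 < y * ψ y) ∧
    ∀ γ : ℝ → ℝ, (∀ y ∈ Set.Ioo A B, HasDerivAt γ (ψ y) y) →
      StrictAntiOn γ (Set.Ioc A 0) ∧ StrictMonoOn γ (Set.Ico 0 B) ∧
      ∀ y ∈ Set.Ioo A B, γ 0 ≤ γ y := by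
  have hs : 0 < √lam := Real.sqrt_pos.2 hlam
  have hs' : √lam ≠ 0 := hs.ne'
  have hπ : 0 < π / 2 * √lam := by positivity
  have hsA : √lam * (A + c) = sinh (arsinh (√lam * c) - π / 2 * √lam) := by
    rw [hA]; field_simp; ring
  have hsB : √lam * (B + c) = sinh (arsinh (√lam * c) + π / 2 * √lam) := by
    rw [hB]; field_simp; ring
  have hA0 : A < 0 := by
    have h : √lam * (A + c) < √lam * c := by
      rw [hsA, ← arsinh_lt_arsinh, arsinh_sinh]; linarith
    linarith [lt_of_mul_lt_mul_left h hs.le]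
  have hB0 : 0 < B := by
    have h : √lam * c < √lam * (B + c) := by
      rw [hsB, ← arsinh_lt_arsinh, arsinh_sinh]; linarith
    linarith [lt_of_mul_lt_mul_left h hs.le]
  have hr (y : ℝ) : 0 < √((y + c) ^ 2 + 1 / lam) := by positivity
  have hpos : ∀ y, 0 < y → y < B → 0 < ψ y := by
    intro y hy hyB
    rw [hψ]
    refine mul_pos (hr y) (tan_pos_of_pos_of_lt_pi_div_two ?_ ?_)
    · have h := arsinh_lt_arsinh.2 (mul_lt_mul_of_pos_left (by linarith : c < y + c) hs)
      exact mul_pos (by positivity) (sub_pos.2 h)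
    · have h := arsinh_lt_arsinh.2
        (mul_lt_mul_of_pos_left (by linarith : y + c < B + c) hs)
      rw [hsB, arsinh_sinh] at h
      rw [one_div_mul_eq_div, div_lt_iff₀ hs]
      linarith
  have hneg : ∀ y, A < y → y < 0 → ψ y < 0 := by
    intro y hyA hy
    rw [hψ]
    refine mul_neg_of_pos_of_neg (hr y) (tan_neg_of_neg_of_pi_div_two_lt ?_ ?_)
    · have h := arsinh_lt_arsinh.2 (mul_lt_mul_of_pos_left (by linarith : y + c < c) hs)
      exact mul_neg_of_pos_of_neg (by positivity) (sub_neg.2 h)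
    · have h := arsinh_lt_arsinh.2
        (mul_lt_mul_of_pos_left (by linarith : A + c < y + c) hs)
      rw [hsA, arsinh_sinh] at h
      rw [one_div_mul_eq_div, lt_div_iff₀ hs]
      linarith
  refine ⟨fun y hy hy0 => ?_, fun γ hγ => ?_⟩
  · rcases hy0.lt_or_gt with h | h
    · exact mul_pos_of_neg_of_neg h (hneg y hy.1 h)
    · exact mul_pos h (hpos y h hy.2)
  have hanti : StrictAntiOn γ (Set.Ioc A 0) := by
    refine strictAntiOn_of_deriv_neg (convex_Ioc A 0)
      (fun y hy => (hγ y ⟨hy.1, hy.2.trans_lt hB0⟩).continuousAt.continuousWithinAt)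
      fun y hy => ?_
    rw [interior_Ioc] at hy
    rw [(hγ y ⟨hy.1, hy.2.trans hB0⟩).deriv]
    exact hneg y hy.1 hy.2
  have hmono : StrictMonoOn γ (Set.Ico 0 B) := by
    refine strictMonoOn_of_deriv_pos (convex_Ico 0 B)
      (fun y hy => (hγ y ⟨hA0.trans_le hy.1, hy.2⟩).continuousAt.continuousWithinAt)
      fun y hy => ?_
    rw [interior_Ico] at hy
    rw [(hγ y ⟨hA0.trans hy.1, hy.2⟩).deriv]
    exact hpos y hy.1 hy.2
  refine ⟨hanti, hmono, fun y hy => ?_⟩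
  rcases le_total y 0 with h | h
  · exact hanti.antitoneOn ⟨hy.1, h⟩ ⟨hA0, le_rfl⟩ h
  · exact hmono.monotoneOn ⟨le_rfl, hB0⟩ ⟨h, hy.2⟩ h
end

section
/- Fix λ > 0 and c ≥ 0, set b = b_{λ,c} = (1/√λ)·sinh(arsinh(√λ c) + (π/2)√λ) − c, and define ψ(y) = √((y+c)² + 1/λ) · tan( (1/√λ)·( arsinh(√λ (y+c)) − arsinh(√λ c) ) ) on (a_{λ,c}, b). Then (b − y)·ψ(y) tends to (1 + λ(c + b)²)/√λ as y → b from the left. In particular any antiderivative γ of ψ satisfies γ(y) ~ −((1 + λ(c+b)²)/√λ)·log(b − y) as y → b⁻, so γ blows up at the right endpoint. -/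
open Real Filter Set

/-- The Bernoulli–Hôpital rule for a denominator tending to infinity at the right endpoint of an interval. -/
theorem tendsto_div_of_tendsto_deriv_div_atTop_left {f f' g g' : ℝ → ℝ} {a b L : ℝ}
    (hab : a < b) (hf : ∀ y ∈ Ioo a b, HasDerivAt f (f' y) y)
    (hg : ∀ y ∈ Ioo a b, HasDerivAt g (g' y) y) (hg' : ∀ y ∈ Ioo a b, 0 < g' y)
    (hL : Tendsto (fun y => f' y / g' y) (nhdsWithin b (Iio b)) (nhds L))
    (hinf : Tendsto g (nhdsWithin b (Iio b)) atTop) :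
    Tendsto (fun y => f y / g y) (nhdsWithin b (Iio b)) (nhds L) := by
  rw [Metric.tendsto_nhds] at hL ⊢
  intro ε hε
  obtain ⟨l, hl, hlL⟩ := (mem_nhdsLT_iff_exists_Ioo_subset' hab).1 (hL (ε / 4) (by positivity))
  have hl' : max l a < b := max_lt hl hab
  obtain ⟨y₀, hy₀, hy₀b⟩ := exists_between hl'
  have key : ∀ y ∈ Ioo y₀ b,
      |(f y - L * g y) - (f y₀ - L * g y₀)| ≤ ε / 4 * (g y - g y₀) := by
    intro y hy
    have hsub : ∀ z ∈ Icc y₀ y, z ∈ Ioo a b := fun z hz =>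
      ⟨(le_max_right l a).trans_lt (hy₀.trans_le hz.1), hz.2.trans_lt hy.2⟩
    have hd : ∀ z ∈ Icc y₀ y, HasDerivAt (fun z => f z - L * g z) (f' z - L * g' z) z :=
      fun z hz => (hf z (hsub z hz)).sub ((hg z (hsub z hz)).const_mul L)
    obtain ⟨ξ, hξ, h⟩ := exists_ratio_hasDerivAt_eq_ratio_slope
      (fun z => f z - L * g z) (fun z => f' z - L * g' z) hy.1
      (fun z hz => (hd z hz).continuousAt.continuousWithinAt)
      (fun z hz => hd z (Ioo_subset_Icc_self hz)) g g'
      (fun z hz => (hg z (hsub z hz)).continuousAt.continuousWithinAt)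
      (fun z hz => hg z (hsub z (Ioo_subset_Icc_self hz)))
    obtain ⟨η, hη, h2⟩ := exists_hasDerivAt_eq_slope g g' hy.1
      (fun z hz => (hg z (hsub z hz)).continuousAt.continuousWithinAt)
      (fun z hz => hg z (hsub z (Ioo_subset_Icc_self hz)))
    have hpos : 0 < g y - g y₀ := by
      have h3 := hg' η (hsub η (Ioo_subset_Icc_self hη))
      rw [h2] at h3
      exact (div_pos_iff_of_pos_right (sub_pos.2 hy.1)).1 h3
    have hgξ := hg' ξ (hsub ξ (Ioo_subset_Icc_self hξ))
    have hε' : dist (f' ξ / g' ξ) L < ε / 4 :=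
      hlL ⟨(le_max_left l a).trans_lt (hy₀.trans hξ.1), hξ.2.trans hy.2⟩
    have heq : (f y - L * g y) - (f y₀ - L * g y₀) = (g y - g y₀) * (f' ξ / g' ξ - L) := by
      field_simp
      linarith
    rw [heq, abs_mul, abs_of_pos hpos, mul_comm]
    exact mul_le_mul_of_nonneg_right (Real.dist_eq _ _ ▸ hε'.le) hpos.le
  filter_upwards [Ioo_mem_nhdsLT hy₀b, hinf.eventually_gt_atTop 0,
    hinf.eventually_gt_atTop ((|f y₀ - L * g y₀| + ε / 4 * |g y₀|) / (ε / 4))] with y hy hpos hbig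
  rw [div_lt_iff₀ (by positivity)] at hbig
  have h1 := key y hy
  have h2 := abs_sub_abs_le_abs_sub (f y - L * g y) (f y₀ - L * g y₀)
  have h3 : ε / 4 * -g y₀ ≤ ε / 4 * |g y₀| :=
    mul_le_mul_of_nonneg_left (neg_le_abs _) (by positivity)
  have heq : f y / g y - L = (f y - L * g y) / g y := by field_simp
  rw [Real.dist_eq, heq, abs_div, abs_of_pos hpos, div_lt_iff₀ hpos]
  nlinarith [mul_pos hε hpos]

/-- Near a point where a differentiable phase crosses `π / 2`, its tangent has a simple pole. -/
theorem tendsto_sub_mul_tan {φ : ℝ → ℝ} {b d : ℝ} (hφ : HasDerivAt φ d b) (hd : d ≠ 0)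
    (hb : φ b = Real.pi / 2) :
    Tendsto (fun y => (b - y) * Real.tan (φ y)) (nhdsWithin b {b}ᶜ) (nhds d⁻¹) := by
  have hcos : HasDerivAt (fun y => Real.cos (φ y)) (-d) b := by
    simpa [hb] using hφ.cos
  have hslope := (hasDerivAt_iff_tendsto_slope.1 hcos).inv₀ (neg_ne_zero.2 hd)
  have hsin : Tendsto (fun y => Real.sin (φ y)) (nhdsWithin b {b}ᶜ) (nhds 1) := by
    have h := hφ.sin.continuousAt.tendsto
    simp only [hb, Real.sin_pi_div_two] at h
    exact h.mono_left nhdsWithin_le_nhds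
  have h := (hslope.mul hsin).neg
  rw [inv_neg, mul_one, neg_neg] at h
  refine h.congr fun y => ?_
  rw [slope_def_field, hb, Real.cos_pi_div_two, sub_zero, inv_div, Real.tan_eq_sin_div_cos]
  ring

/-- `(b − y)·ψ(y) → (1 + λ(c+b)²)/√λ` as `y → b⁻`; consequently any antiderivative `γ`
of `ψ` satisfies `γ(y) ~ −((1 + λ(c+b)²)/√λ)·log(b − y)` as `y → b⁻`. -/
theorem grim_reaper_blow_up
    (lam c : ℝ) (hlam : 0 < lam) (hc : 0 ≤ c) (A B : ℝ)
    (hA : A = (1 / Real.sqrt lam) *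
      Real.sinh (Real.arsinh (Real.sqrt lam * c) - (Real.pi / 2) * Real.sqrt lam) - c)
    (hB : B = (1 / Real.sqrt lam) *
      Real.sinh (Real.arsinh (Real.sqrt lam * c) + (Real.pi / 2) * Real.sqrt lam) - c)
    (ψ : ℝ → ℝ)
    (hψ : ∀ y : ℝ, ψ y = Real.sqrt ((y + c) ^ 2 + 1 / lam) *
      Real.tan ((1 / Real.sqrt lam) *
        (Real.arsinh (Real.sqrt lam * (y + c)) - Real.arsinh (Real.sqrt lam * c)))) :
    Filter.Tendsto (fun y : ℝ => (B - y) * ψ y) (nhdsWithin B (Set.Iio B))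
      (nhds ((1 + lam * (c + B) ^ 2) / Real.sqrt lam)) ∧
    ∀ γ : ℝ → ℝ, (∀ y ∈ Set.Ioo A B, HasDerivAt γ (ψ y) y) →
      Filter.Tendsto
        (fun y : ℝ => γ y / (-((1 + lam * (c + B) ^ 2) / Real.sqrt lam) * Real.log (B - y)))
        (nhdsWithin B (Set.Iio B)) (nhds 1) := by
  set s := Real.sqrt lam with hs
  have hs0 : 0 < s := Real.sqrt_pos.2 hlam
  have hss : s ^ 2 = lam := Real.sq_sqrt hlam.le
  have hAB : A < B := by
    rw [hA, hB]
    have h : Real.sinh (Real.arsinh (s * c) - Real.pi / 2 * s) <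
        Real.sinh (Real.arsinh (s * c) + Real.pi / 2 * s) := by
      rw [Real.sinh_lt_sinh]
      have : 0 < Real.pi / 2 * s := by positivity
      linarith
    have := mul_lt_mul_of_pos_left h (one_div_pos.2 hs0)
    linarith
  have hK : 0 < (1 + lam * (c + B) ^ 2) / s := by positivity
  have hlim : Tendsto (fun y : ℝ => (B - y) * ψ y) (nhdsWithin B (Iio B))
      (nhds ((1 + lam * (c + B) ^ 2) / s)) := by
    have hφB : 1 / s * (Real.arsinh (s * (B + c)) - Real.arsinh (s * c)) = Real.pi / 2 := by
      have h : s * (B + c) = Real.sinh (Real.arsinh (s * c) + Real.pi / 2 * s) := by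
        rw [hB]
        field_simp
        ring
      rw [h, Real.arsinh_sinh]
      field_simp
      ring
    have hφ : HasDerivAt (fun y => 1 / s * (Real.arsinh (s * (y + c)) - Real.arsinh (s * c)))
        (Real.sqrt (1 + (s * (B + c)) ^ 2))⁻¹ B := by
      have h := ((((((hasDerivAt_id B).add_const c).const_mul s).arsinh).sub_const
        (Real.arsinh (s * c))).const_mul (1 / s))
      refine h.congr_deriv ?_
      simp only [id, smul_eq_mul]
      field_simp
    have hr : 0 < Real.sqrt (1 + (s * (B + c)) ^ 2) := by positivity
    have htan := (tendsto_sub_mul_tan hφ (inv_ne_zero hr.ne') hφB).mono_left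
      (nhdsWithin_mono B fun y (hy : y < B) => hy.ne)
    have hsqrt : Tendsto (fun y => Real.sqrt ((y + c) ^ 2 + 1 / lam)) (nhdsWithin B (Iio B))
        (nhds (Real.sqrt ((B + c) ^ 2 + 1 / lam))) := by
      refine Continuous.continuousWithinAt ?_
      fun_prop
    have h := hsqrt.mul htan
    have hval : Real.sqrt ((B + c) ^ 2 + 1 / lam) * (Real.sqrt (1 + (s * (B + c)) ^ 2))⁻¹⁻¹
        = (1 + lam * (c + B) ^ 2) / s := by
      have h1 : (B + c) ^ 2 + 1 / lam = (1 + (s * (B + c)) ^ 2) / lam := by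
        rw [mul_pow, hss]
        field_simp
        ring
      rw [inv_inv, h1, Real.sqrt_div (by positivity), ← hs, div_mul_eq_mul_div,
        Real.mul_self_sqrt (by positivity), mul_pow, hss, add_comm B c]
    rw [hval] at h
    refine h.congr fun y => ?_
    rw [hψ]
    ring
  refine ⟨hlim, fun γ hγ => ?_⟩
  have hlog : ∀ y ∈ Ioo A B, HasDerivAt (fun y => -Real.log (B - y)) (1 / (B - y)) y := by
    intro y hy
    have h := (((hasDerivAt_id y).const_sub B).log (sub_pos.2 hy.2).ne').neg
    exact h.congr_deriv (by simp [neg_div])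
  have hinf : Tendsto (fun y => -Real.log (B - y)) (nhdsWithin B (Iio B)) atTop := by
    refine tendsto_neg_atBot_atTop.comp (Real.tendsto_log_nhdsGT_zero.comp ?_)
    refine tendsto_nhdsWithin_iff.2 ⟨?_, ?_⟩
    · have h : Continuous fun y : ℝ => B - y := by fun_prop
      simpa using (h.tendsto B).mono_left nhdsWithin_le_nhds
    · filter_upwards [self_mem_nhdsWithin] with y hy using sub_pos.2 (mem_Iio.1 hy)
  have hratio := tendsto_div_of_tendsto_deriv_div_atTop_left hAB hγ hlog
    (fun y hy => one_div_pos.2 (sub_pos.2 hy.2))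
    (hlim.congr fun y => by
      rw [div_div_eq_mul_div, div_one, mul_comm]) hinf
  have h := hratio.div_const ((1 + lam * (c + B) ^ 2) / s)
  rw [div_self hK.ne'] at h
  refine h.congr fun y => ?_
  rw [div_div, neg_mul_comm, mul_comm (Real.log (B - y))]
end

section
/- Fix λ > 0 and r₀ > 0, and let ψ : (r₀, ∞) → ℝ be differentiable with ψ'(r) = 1/√λ + (4ψ(r)/(r(λr² + 4)))·( √λ·r·ψ(r) − 1 − λ·ψ(r)² ) for all r > r₀. Then ψ(r)/r tends to 1/√λ as r → ∞. -/
open Real Filter Set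

/-- Along the translator ODE, `(√λ ψ - r)²` has derivative at most `1 / (2 r)`. -/
lemma sq_sqrt_mul_sub_deriv_le {lam s r p : ℝ} (hs : 0 < s) (hsq : s ^ 2 = lam) (hr : 0 < r) :
    2 * (s * p - r) * (s * (1 / s + (4 * p / (r * (lam * r ^ 2 + 4))) *
      (s * r * p - 1 - lam * p ^ 2)) - 1) ≤ 1 / (2 * r) := by
  subst hsq
  have hD : 0 < s ^ 2 * r ^ 2 + 4 := by positivity
  have hX : -(s * p * (s * p - r)) ^ 2 - s * p * (s * p - r) ≤ 1 / 4 := by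
    nlinarith [sq_nonneg (s * p * (s * p - r) + 1 / 2)]
  calc _ = 8 * (-(s * p * (s * p - r)) ^ 2 - s * p * (s * p - r)) /
        (r * (s ^ 2 * r ^ 2 + 4)) := by
        field_simp
        ring
    _ ≤ 2 / (r * (s ^ 2 * r ^ 2 + 4)) := by
        gcongr
        linarith
    _ ≤ 2 / (r * 4) := by
        gcongr
        nlinarith [sq_nonneg (s * r)]
    _ = 1 / (2 * r) := by
        field_simp
        norm_num

/-- If `(f r - r)²` grows at most linearly, then `f r / r → 1`. -/
lemma tendsto_div_self_of_sq_sub_le {f : ℝ → ℝ} {C K : ℝ}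
    (h : ∀ᶠ r in atTop, (f r - r) ^ 2 ≤ C + K * r) :
    Tendsto (fun r => f r / r) atTop (nhds 1) := by
  have hlim : Tendsto (fun r : ℝ => C * (r⁻¹ * r⁻¹) + K * r⁻¹) atTop (nhds 0) := by
    have h0 := tendsto_inv_atTop_zero (𝕜 := ℝ)
    simpa using ((h0.mul h0).const_mul C).add (h0.const_mul K)
  have hsq : Tendsto (fun r => (f r / r - 1) ^ 2) atTop (nhds 0) := by
    refine squeeze_zero' (Eventually.of_forall fun r => sq_nonneg _) ?_ hlim
    filter_upwards [h, eventually_gt_atTop 0] with r hr hpos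
    calc (f r / r - 1) ^ 2 = (f r - r) ^ 2 / r ^ 2 := by field_simp
      _ ≤ (C + K * r) / r ^ 2 := by gcongr
      _ = C * (r⁻¹ * r⁻¹) + K * r⁻¹ := by field_simp
  have habs : Tendsto (fun r => |f r / r - 1|) atTop (nhds 0) := by
    simpa [Real.sqrt_sq_eq_abs] using hsq.sqrt
  simpa using ((tendsto_zero_iff_abs_tendsto_zero _).2 habs).add_const 1

/-- For the rotationally invariant translator ODE in `(Nil₃, g_λ)`, the solution satisfies
`ψ(r)/r → 1/√λ` as `r → ∞`. -/
theorem rotational_translator_linear_growth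
    (lam r₀ : ℝ) (hlam : 0 < lam) (hr₀ : 0 < r₀) (ψ : ℝ → ℝ)
    (hψ : ∀ r : ℝ, r₀ < r →
      HasDerivAt ψ
        (1 / Real.sqrt lam +
          (4 * ψ r / (r * (lam * r ^ 2 + 4))) *
            (Real.sqrt lam * r * ψ r - 1 - lam * (ψ r) ^ 2)) r) :
    Filter.Tendsto (fun r : ℝ => ψ r / r) Filter.atTop (nhds (1 / Real.sqrt lam)) := by
  have hs : 0 < √lam := Real.sqrt_pos.2 hlam
  have hderiv (r : ℝ) (hr : r₀ < r) :=
    (((hψ r hr).const_mul √lam).sub (hasDerivAt_id r)).pow 2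
  have hgrowth (r : ℝ) (hr : r₀ + 1 ≤ r) : (√lam * ψ r - r) ^ 2 ≤
      ((√lam * ψ (r₀ + 1) - (r₀ + 1)) ^ 2 - 1 / (2 * r₀) * (r₀ + 1)) + 1 / (2 * r₀) * r := by
    have key := (convex_Ici (r₀ + 1)).image_sub_le_mul_sub_of_deriv_le
      (f := fun r => (√lam * ψ r - r) ^ 2) (C := 1 / (2 * r₀))
      (fun x hx => (hderiv x (by linarith [mem_Ici.1 hx])).continuousAt.continuousWithinAt)
      (fun x hx => (hderiv x
        (by linarith [mem_Ici.1 (interior_subset hx)])).differentiableAt.differentiableWithinAt)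
      (fun x hx => by
        have hx' : r₀ < x := by linarith [mem_Ici.1 (interior_subset hx)]
        have hle := sq_sqrt_mul_sub_deriv_le (p := ψ x) hs (Real.sq_sqrt hlam.le) (hr₀.trans hx')
        have hbound : 1 / (2 * x) ≤ 1 / (2 * r₀) := by gcongr
        refine (hderiv x hx').deriv.trans_le ?_
        simpa using hle.trans hbound)
      (r₀ + 1) self_mem_Ici r hr hr
    linarith
  have hlim := (tendsto_div_self_of_sq_sub_le (f := fun r => √lam * ψ r)
    ((eventually_ge_atTop (r₀ + 1)).mono hgrowth)).div_const √lam
  refine hlim.congr fun r => ?_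
  field_simp
end

section
/- Fix λ > 0 and r₀ > 0, and let ψ : (r₀, ∞) → ℝ be differentiable with ψ'(r) = 1/√λ + (4ψ(r)/(r(λr² + 4)))·( √λ·r·ψ(r) − 1 − λ·ψ(r)² ) for all r > r₀. Then the function q(r) = ψ(r) − r/√λ tends to 0 as r → ∞. -/
open Real Filter Set

theorem antitoneOn_Ioi_of_hasDerivAt_nonpos {f f' : ℝ → ℝ} {a : ℝ}
    (hf : ∀ x, a < x → HasDerivAt f (f' x) x) (hf' : ∀ x, a < x → f' x ≤ 0) :
    AntitoneOn f (Ioi a) := by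
  refine antitoneOn_of_deriv_nonpos (convex_Ioi a)
    (fun x hx => (hf x hx).continuousAt.continuousWithinAt) ?_ ?_
  · intro x hx
    rw [interior_Ioi] at hx
    exact (hf x hx).differentiableAt.differentiableWithinAt
  · intro x hx
    rw [interior_Ioi] at hx
    rw [(hf x hx).deriv]
    exact hf' x hx

/-- A nonnegative function cannot satisfy `f' ≤ -c / x` near infinity with `c > 0`. -/
theorem not_forall_hasDerivAt_le_neg_div {f f' : ℝ → ℝ} {a c : ℝ} (ha : 0 < a) (hc : 0 < c)
    (hf : ∀ x, a < x → HasDerivAt f (f' x) x) (hf' : ∀ x, a < x → f' x ≤ -c / x)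
    (hnonneg : ∀ x, a < x → 0 ≤ f x) : False := by
  have hanti : AntitoneOn (fun x => f x + c * log x) (Ioi a) :=
    antitoneOn_Ioi_of_hasDerivAt_nonpos (f' := fun x => f' x + c * x⁻¹)
      (fun x hx => (hf x hx).add ((hasDerivAt_log (ha.trans hx).ne').const_mul c))
      (fun x hx => by
        have h := hf' x hx
        rw [neg_div, div_eq_mul_inv] at h
        linarith)
  have hlog : Tendsto (fun x => c * log x) atTop atTop :=
    tendsto_log_atTop.const_mul_atTop hc
  obtain ⟨x, hx, hxa⟩ := ((hlog.eventually_gt_atTop (f (a + 1) + c * log (a + 1))).and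
    (eventually_gt_atTop (a + 1))).exists
  have hax : a < x := by linarith
  have h := hanti (show a < a + 1 by linarith) hax hxa.le
  have h0 := hnonneg x hax
  dsimp only at h
  linarith

/-- Solutions of the rescaled equation `p' = -4 (r + p) (1 + (r + p) p) / (r (λ r² + 4))`
tend to zero: `p² + 1 / (λ r²)` is a Lyapunov function. -/
theorem tendsto_zero_of_rescaled_translator_ode {lam r₀ : ℝ} (hlam : 0 < lam) (hr₀ : 0 < r₀)
    {p : ℝ → ℝ}
    (hp : ∀ r, r₀ < r →
      HasDerivAt p (-4 * (r + p r) * (1 + (r + p r) * p r) / (r * (lam * r ^ 2 + 4))) r) :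
    Tendsto p atTop (nhds 0) := by
  set W : ℝ → ℝ := fun r => p r ^ 2 + lam⁻¹ * (r ^ 2)⁻¹ with hW
  set w : ℝ → ℝ := fun r => (r + p r) * p r with hw
  set W' : ℝ → ℝ := fun r =>
    -8 * (w r * (1 + w r)) / (r * (lam * r ^ 2 + 4)) - 2 / (lam * r ^ 3) with hW'
  have hWd : ∀ r, r₀ < r → HasDerivAt W (W' r) r := by
    intro r hr
    have hr0 : 0 < r := hr₀.trans hr
    have hne : r ^ 2 ≠ 0 := by positivity
    have h := ((hp r hr).pow 2).add ((((hasDerivAt_id r).pow 2).inv hne).const_mul lam⁻¹)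
    refine h.congr_deriv ?_
    have : lam * r ^ 2 + 4 ≠ 0 := by positivity
    simp only [hW', hw, id, Pi.pow_apply]
    field_simp
    ring
  have hanti : AntitoneOn W (Ioi r₀) := by
    refine antitoneOn_Ioi_of_hasDerivAt_nonpos hWd fun r hr => ?_
    have hr0 : 0 < r := hr₀.trans hr
    have h1 : -8 * (w r * (1 + w r)) / (r * (lam * r ^ 2 + 4)) ≤ 2 / (r * (lam * r ^ 2 + 4)) := by
      gcongr
      nlinarith [sq_nonneg (2 * w r + 1)]
    have h2 : 2 / (r * (lam * r ^ 2 + 4)) ≤ 2 / (lam * r ^ 3) :=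
      div_le_div_of_nonneg_left two_pos.le (by positivity) (by linarith)
    simp only [hW']
    linarith
  have hpW : ∀ r, p r ^ 2 ≤ W r := fun r => by
    have : 0 ≤ lam⁻¹ * (r ^ 2)⁻¹ := by positivity
    simp only [hW]
    linarith
  have hsmall : ∀ ε > 0, ∃ r, r₀ < r ∧ W r < ε := by
    intro ε hε
    by_contra! hbig
    have hinv : Tendsto (fun r : ℝ => lam⁻¹ * (r ^ 2)⁻¹) atTop (nhds 0) := by
      simpa using (tendsto_inv_atTop_zero.comp
        (tendsto_pow_atTop (α := ℝ) two_ne_zero)).const_mul lam⁻¹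
    set M := W (r₀ + 1)
    set δ := ε / 2 with hδ
    have hδ0 : 0 < δ := half_pos hε
    have hsq : Tendsto (fun r : ℝ => δ / 8 * r ^ 2) atTop atTop :=
      (tendsto_pow_atTop two_ne_zero).const_mul_atTop (by positivity)
    obtain ⟨R, hR⟩ := ((hinv.eventually_lt_const hδ0).and
      ((hsq.eventually_ge_atTop (M ^ 2 / 2 + 1 / 2)).and
        ((eventually_ge_atTop 2).and (eventually_ge_atTop (r₀ + 1))))).exists_forall_of_atTop
    obtain ⟨-, -, hR2, hRr⟩ := hR R le_rfl
    refine not_forall_hasDerivAt_le_neg_div (f := W) (f' := W') (a := R) (c := δ / (lam + 1))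
      (by linarith) (by positivity) (fun r hr => hWd r (by linarith)) (fun r hr => ?_)
      (fun r _ => (sq_nonneg _).trans (hpW r))
    obtain ⟨h1, h2, h3, h4⟩ := hR r hr.le
    have hr0 : 0 < r := by linarith
    have hVlow : δ ≤ p r ^ 2 := by
      have := hbig r (by linarith)
      simp only [hW] at this
      linarith
    have hVup : p r ^ 2 ≤ M :=
      (hpW r).trans (hanti (show r₀ < r₀ + 1 by linarith) (show r₀ < r by linarith) h4)
    have hwlow : δ * r ^ 2 / 2 - M ^ 2 ≤ w r ^ 2 := by
      have e : w r ^ 2 = p r ^ 2 * (r + p r) ^ 2 := by simp only [hw]; ring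
      have e1 : r ^ 2 / 2 - p r ^ 2 ≤ (r + p r) ^ 2 := by nlinarith [sq_nonneg (r + 2 * p r)]
      have e2 := mul_le_mul_of_nonneg_left e1 (sq_nonneg (p r))
      have e3 := mul_le_mul_of_nonneg_right hVlow (sq_nonneg r)
      have e4 : (p r ^ 2) ^ 2 ≤ M ^ 2 := pow_le_pow_left₀ (sq_nonneg _) hVup 2
      nlinarith
    have hww : δ * r ^ 2 / 8 ≤ w r * (1 + w r) := by
      nlinarith [sq_nonneg (w r + 1)]
    have h5 : -8 * (w r * (1 + w r)) / (r * (lam * r ^ 2 + 4)) ≤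
        -(δ * r ^ 2) / (r * (lam * r ^ 2 + 4)) := by
      gcongr
      linarith
    have h6 : δ / (lam + 1) / r ≤ δ * r ^ 2 / (r * (lam * r ^ 2 + 4)) := by
      rw [div_div, div_le_div_iff₀ (by positivity) (by positivity)]
      have : 0 ≤ δ * r * (r ^ 2 - 4) := mul_nonneg (by positivity) (by nlinarith)
      nlinarith
    have h7 : 0 ≤ 2 / (lam * r ^ 3) := by positivity
    simp only [hW']
    rw [neg_div] at h5 ⊢
    linarith
  rw [Metric.tendsto_atTop]
  intro ε hε
  obtain ⟨R, hR, hWR⟩ := hsmall (ε ^ 2) (by positivity)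
  refine ⟨R, fun r hr => ?_⟩
  have h := (hpW r).trans (hanti hR (hR.trans_le hr) hr)
  rw [dist_zero_right, norm_eq_abs]
  exact abs_lt_of_sq_lt_sq (h.trans_lt hWR) hε.le

/-- For the rotationally invariant translator ODE in `(Nil₃, g_λ)`, the quantity
`q(r) = ψ(r) − r/√λ` tends to `0` as `r → ∞`. -/
theorem rotational_translator_q_tendsto_zero
    (lam r₀ : ℝ) (hlam : 0 < lam) (hr₀ : 0 < r₀) (ψ : ℝ → ℝ)
    (hψ : ∀ r : ℝ, r₀ < r →
      HasDerivAt ψ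
        (1 / Real.sqrt lam +
          (4 * ψ r / (r * (lam * r ^ 2 + 4))) *
            (Real.sqrt lam * r * ψ r - 1 - lam * (ψ r) ^ 2)) r) :
    Filter.Tendsto (fun r : ℝ => ψ r - r / Real.sqrt lam) Filter.atTop (nhds 0) := by
  have hs : 0 < √lam := sqrt_pos.2 hlam
  have hp : Tendsto (fun r => √lam * ψ r - r) atTop (nhds 0) := by
    refine tendsto_zero_of_rescaled_translator_ode hlam hr₀ fun r hr => ?_
    have hr0 : 0 < r := hr₀.trans hr
    refine (((hψ r hr).const_mul √lam).sub (hasDerivAt_id r)).congr_deriv ?_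
    have hd : lam * r ^ 2 + 4 ≠ 0 := by positivity
    have hsq : lam * ψ r ^ 2 = (√lam * ψ r) ^ 2 := by rw [mul_pow, sq_sqrt hlam.le]
    rw [hsq]
    field_simp
    ring
  have h := hp.div_const √lam
  rw [zero_div] at h
  refine h.congr fun r => ?_
  field_simp
end

section
/- Fix λ with 0 < λ < 4 and r₀ > 0, and let ψ : (r₀, ∞) → ℝ be differentiable with ψ'(r) = 1/√λ + (4ψ(r)/(r(λr² + 4)))·( √λ·r·ψ(r) − 1 − λ·ψ(r)² ) for all r > r₀. Then r·(ψ(r) − r/√λ) tends to −4/(√λ·(4−λ)) as r → ∞. Consequently φ(r) = ∫ψ has the asymptotic expansion φ(r) ≈ r²/(2√λ) − (4/(√λ(4−λ)))·log(r) as r → ∞. -/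
open Real Filter Set

/-- If `f' ≤ -δ θ'` whenever `f ≥ b`, for an increasing gauge `θ → ∞`, then eventually
`f ≤ b`. -/
lemma eventually_le_of_deriv_le_neg_gauge {f f' θ θ' : ℝ → ℝ} {b δ : ℝ}
    (hf : ∀ᶠ r in atTop, HasDerivAt f (f' r) r)
    (hθ : ∀ᶠ r in atTop, HasDerivAt θ (θ' r) r)
    (hθ_pos : ∀ᶠ r in atTop, 0 < θ' r) (hθ_top : Tendsto θ atTop atTop) (hδ : 0 < δ)
    (h : ∀ᶠ r in atTop, b ≤ f r → f' r ≤ -δ * θ' r) :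
    ∀ᶠ r in atTop, f r ≤ b := by
  obtain ⟨R, hR⟩ := eventually_atTop.1 (hf.and (hθ.and (hθ_pos.and h)))
  obtain ⟨r₁, hr₁, hfr₁⟩ : ∃ r₁, R ≤ r₁ ∧ f r₁ ≤ b := by
    by_contra! hcon
    have hderiv : ∀ r, R ≤ r → HasDerivAt (fun x => f x + δ * θ x) (f' r + δ * θ' r) r :=
      fun r hr => (hR r hr).1.add ((hR r hr).2.1.const_mul δ)
    have hanti : AntitoneOn (fun x => f x + δ * θ x) (Ici R) := by
      refine antitoneOn_of_hasDerivWithinAt_nonpos (convex_Ici R)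
        (fun r hr => (hderiv r hr).continuousAt.continuousWithinAt)
        (fun r hr => (hderiv r (interior_subset hr)).hasDerivWithinAt) fun r hr => ?_
      have hr' : R ≤ r := interior_subset hr
      have := (hR r hr').2.2.2 (hcon r hr').le
      linarith
    obtain ⟨r, hr, hrR⟩ := ((hθ_top.eventually_gt_atTop ((f R + δ * θ R - b) / δ)).and
      (eventually_ge_atTop R)).exists
    have h₁ := hanti self_mem_Ici hrR hrR
    have h₂ := hcon r hrR
    rw [div_lt_iff₀ hδ] at hr
    simp only at h₁
    linarith
  filter_upwards [eventually_ge_atTop r₁] with r hr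
  refine image_le_of_deriv_right_lt_deriv_boundary (f := f) (f' := f') (a := r₁) (b := r)
    (B := fun _ => b) (B' := fun _ => 0)
    (fun x hx => (hR x (hr₁.trans hx.1)).1.continuousAt.continuousWithinAt)
    (fun x hx => (hR x (hr₁.trans hx.1)).1.hasDerivWithinAt) hfr₁
    (fun x => hasDerivAt_const x b) (fun x hx hxb => ?_) ⟨hr, le_rfl⟩
  obtain ⟨-, -, hpos, hle⟩ := hR x (hr₁.trans hx.1)
  have := hle hxb.ge
  nlinarith

/-- A function driven towards `L` at a rate bounded below by a divergent gauge converges to `L`. -/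
lemma tendsto_of_deriv_gauge {f f' θ θ' : ℝ → ℝ} {L : ℝ}
    (hf : ∀ᶠ r in atTop, HasDerivAt f (f' r) r)
    (hθ : ∀ᶠ r in atTop, HasDerivAt θ (θ' r) r)
    (hθ_pos : ∀ᶠ r in atTop, 0 < θ' r) (hθ_top : Tendsto θ atTop atTop)
    (h : ∀ ε > 0, ∃ δ > 0, ∀ᶠ r in atTop,
      (L + ε ≤ f r → f' r ≤ -δ * θ' r) ∧ (f r ≤ L - ε → δ * θ' r ≤ f' r)) :
    Tendsto f atTop (nhds L) := by
  rw [Metric.tendsto_nhds]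
  intro ε hε
  obtain ⟨δ, hδ, hev⟩ := h (ε / 2) (half_pos hε)
  have hup := eventually_le_of_deriv_le_neg_gauge hf hθ hθ_pos hθ_top hδ
    (hev.mono fun _ hr => hr.1)
  have hdown := eventually_le_of_deriv_le_neg_gauge (f := fun r => -f r) (f' := fun r => -f' r)
    (b := -(L - ε / 2)) (hf.mono fun _ hr => hr.neg) hθ hθ_pos hθ_top hδ
    (hev.mono fun r hr hb => by have := hr.2 (by linarith); linarith)
  filter_upwards [hup, hdown] with r h₁ h₂
  rw [Real.dist_eq, abs_lt]
  constructor <;> linarith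

lemma eventually_hasDerivAt_log : ∀ᶠ r : ℝ in atTop, HasDerivAt Real.log r⁻¹ r :=
  (eventually_ne_atTop 0).mono fun _ hr => Real.hasDerivAt_log hr

/-- If `r f'(r)` equals `-A(r) f(r) - B(r)` with `A → κ > 0` and `B → β`, then `f → -β / κ`. -/
lemma tendsto_of_euler_ode {f A B : ℝ → ℝ} {κ β : ℝ} (hκ : 0 < κ)
    (hA : Tendsto A atTop (nhds κ)) (hB : Tendsto B atTop (nhds β))
    (hf : ∀ᶠ r in atTop, HasDerivAt f ((-A r * f r - B r) * r⁻¹) r) :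
    Tendsto f atTop (nhds (-β / κ)) := by
  refine tendsto_of_deriv_gauge hf eventually_hasDerivAt_log
    ((eventually_gt_atTop 0).mono fun r hr => inv_pos.2 hr) Real.tendsto_log_atTop
    fun ε hε => ⟨κ * ε / 4, by positivity, ?_⟩
  have hlim : Tendsto (fun r => B r + A r * (-β / κ)) atTop (nhds 0) := by
    have := hB.add (hA.mul_const (-β / κ))
    rwa [mul_div_cancel₀ _ hκ.ne', add_neg_cancel] at this
  have hsmall : 0 < κ * ε / 4 := by positivity
  filter_upwards [hA.eventually_const_lt (half_lt_self hκ), hlim.eventually_lt_const hsmall,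
    hlim.eventually_const_lt (neg_lt_zero.2 hsmall), eventually_gt_atTop 0] with r hAr h₁ h₂ hr
  have hr' : 0 ≤ r⁻¹ := (inv_pos.2 hr).le
  constructor
  · intro hfr
    refine mul_le_mul_of_nonneg_right ?_ hr'
    nlinarith [mul_le_mul hAr.le (show ε ≤ f r - -β / κ by linarith) hε.le (by linarith)]
  · intro hfr
    refine mul_le_mul_of_nonneg_right ?_ hr'
    nlinarith [mul_le_mul hAr.le (show ε ≤ -β / κ - f r by linarith) hε.le (by linarith)]

/-- L'Hôpital's rule against the logarithm. -/
lemma tendsto_div_log_of_tendsto_mul_deriv {g g' : ℝ → ℝ} {L : ℝ}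
    (hg : ∀ᶠ r in atTop, HasDerivAt g (g' r) r)
    (hlim : Tendsto (fun r => r * g' r) atTop (nhds L)) :
    Tendsto (fun r => g r / Real.log r) atTop (nhds L) := by
  have hderiv : ∀ᶠ r in atTop, HasDerivAt (fun r => g r / Real.log r)
      ((r * g' r - g r / Real.log r) * (r⁻¹ / Real.log r)) r := by
    filter_upwards [hg, eventually_gt_atTop 1] with r hgr hr
    have hlog := (Real.log_pos hr).ne'
    have hr0 : r ≠ 0 := by positivity
    refine (hgr.div (Real.hasDerivAt_log hr0) hlog).congr_deriv ?_
    field_simp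
  refine tendsto_of_deriv_gauge (θ := fun r => Real.log (Real.log r))
    (θ' := fun r => r⁻¹ / Real.log r) hderiv ?_ ?_
    (Real.tendsto_log_atTop.comp Real.tendsto_log_atTop) fun ε hε => ⟨ε / 2, half_pos hε, ?_⟩
  · filter_upwards [eventually_gt_atTop 1] with r hr
    exact (Real.hasDerivAt_log (by positivity)).log (Real.log_pos hr).ne'
  · filter_upwards [eventually_gt_atTop 1] with r hr
    have := Real.log_pos hr
    positivity
  · filter_upwards [eventually_gt_atTop 1,
      hlim.eventually_lt_const (show L < L + ε / 2 by linarith),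
      hlim.eventually_const_lt (show L - ε / 2 < L by linarith)] with r hr h₁ h₂
    have hpos : 0 ≤ r⁻¹ / Real.log r := by
      have := Real.log_pos hr
      positivity
    exact ⟨fun h => mul_le_mul_of_nonneg_right (by linarith) hpos,
      fun h => mul_le_mul_of_nonneg_right (by linarith) hpos⟩

/-- The relative deviation `q` of a translator from its leading term satisfies
`r q' = -q (1 + a (1 + q)²) - a (1 + q) / r²` with `a` bounded, and hence tends to `0`. -/
lemma tendsto_zero_of_relative_deviation_ode {q a : ℝ → ℝ} {C : ℝ}
    (ha : ∀ r, 0 ≤ a r) (haC : ∀ r, a r ≤ C)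
    (hq : ∀ᶠ r in atTop, HasDerivAt q
      ((-q r * (1 + a r * (1 + q r) ^ 2) - a r * (1 + q r) / r ^ 2) * r⁻¹) r) :
    Tendsto q atTop (nhds 0) := by
  refine tendsto_of_deriv_gauge hq eventually_hasDerivAt_log
    ((eventually_gt_atTop 0).mono fun r hr => inv_pos.2 hr) Real.tendsto_log_atTop
    fun ε hε => ⟨ε / 2, half_pos hε, ?_⟩
  have hlim : Tendsto (fun r : ℝ => C / r ^ 2) atTop (nhds 0) :=
    tendsto_const_nhds.div_atTop (tendsto_pow_atTop two_ne_zero)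
  filter_upwards [eventually_gt_atTop 0, hlim.eventually_lt_const (half_pos hε)] with r hr hC
  have hr' : 0 ≤ r⁻¹ := (inv_pos.2 hr).le
  have hr2 : 0 < r ^ 2 := by positivity
  have har := ha r
  have hb : 0 ≤ a r * (1 + q r) ^ 2 := by positivity
  constructor
  · intro h
    refine mul_le_mul_of_nonneg_right ?_ hr'
    have h₁ : 0 ≤ a r * (1 + q r) / r ^ 2 := by
      have : 0 ≤ 1 + q r := by linarith
      positivity
    nlinarith [mul_nonneg (show 0 ≤ q r by linarith) hb]
  · intro h
    refine mul_le_mul_of_nonneg_right ?_ hr'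
    have h₁ : a r * (1 + q r) / r ^ 2 ≤ C / r ^ 2 := by
      gcongr
      nlinarith [haC r, mul_nonneg har (show 0 ≤ -q r by linarith)]
    nlinarith [mul_nonneg (show 0 ≤ -q r by linarith) hb]

/-- Asymptotics of the rotationally invariant translator in `(Nil₃, g_λ)` for `0 < λ < 4`:
`r·(ψ(r) − r/√λ) → −4/(√λ(4−λ))`, hence any antiderivative `φ` of `ψ` satisfies
`φ(r) ≈ r²/(2√λ) − (4/(√λ(4−λ)))·log r` as `r → ∞`. -/
theorem rotational_translator_asymptotics_lam_lt_four
    (lam r₀ : ℝ) (hlam : 0 < lam) (hlam4 : lam < 4) (hr₀ : 0 < r₀) (ψ : ℝ → ℝ)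
    (hψ : ∀ r : ℝ, r₀ < r →
      HasDerivAt ψ
        (1 / Real.sqrt lam +
          (4 * ψ r / (r * (lam * r ^ 2 + 4))) *
            (Real.sqrt lam * r * ψ r - 1 - lam * (ψ r) ^ 2)) r) :
    Filter.Tendsto (fun r : ℝ => r * (ψ r - r / Real.sqrt lam)) Filter.atTop
      (nhds (-4 / (Real.sqrt lam * (4 - lam)))) ∧
    ∀ φ : ℝ → ℝ, (∀ r : ℝ, r₀ < r → HasDerivAt φ (ψ r) r) →
      Filter.Tendsto
        (fun r : ℝ => (φ r - r ^ 2 / (2 * Real.sqrt lam)) / Real.log r) Filter.atTop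
        (nhds (-4 / (Real.sqrt lam * (4 - lam)))) := by
  obtain ⟨s, hs⟩ : ∃ s, s = Real.sqrt lam := ⟨_, rfl⟩
  have hs0 : 0 < s := hs ▸ Real.sqrt_pos.2 hlam
  have hs2 : s ^ 2 = lam := by rw [hs, Real.sq_sqrt hlam.le]
  rw [← hs] at hψ ⊢
  set a : ℝ → ℝ := fun r => 4 * r ^ 2 / (lam * r ^ 2 + 4) with ha_def
  set q : ℝ → ℝ := fun r => s * ψ r / r - 1 with hq_def
  have ha_nonneg : ∀ r, 0 ≤ a r := fun r => by positivity
  have ha_le : ∀ r, a r ≤ 4 / lam := fun r => by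
    rw [ha_def, div_le_div_iff₀ (by positivity) hlam]
    nlinarith
  have ha_lim : Tendsto a atTop (nhds (4 / lam)) := by
    have hinv : Tendsto (fun r : ℝ => 4 / r ^ 2) atTop (nhds 0) :=
      tendsto_const_nhds.div_atTop (tendsto_pow_atTop two_ne_zero)
    have h := (tendsto_const_nhds (x := (4 : ℝ))).div (hinv.const_add lam)
      (by rw [add_zero]; exact hlam.ne')
    rw [add_zero] at h
    refine h.congr' ?_
    filter_upwards [eventually_gt_atTop 0] with r hr
    simp only [ha_def, Pi.div_apply]
    field_simp
  have hq_deriv : ∀ r, r₀ < r → HasDerivAt q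
      ((-q r * (1 + a r * (1 + q r) ^ 2) - a r * (1 + q r) / r ^ 2) * r⁻¹) r := fun r hr => by
    have hr0 : 0 < r := hr₀.trans hr
    have hden : lam * r ^ 2 + 4 ≠ 0 := by positivity
    refine ((((hψ r hr).const_mul s).div (hasDerivAt_id r) hr0.ne').sub_const 1).congr_deriv ?_
    simp only [ha_def, hq_def, id]
    rw [← hs2] at hden ⊢
    field_simp
    ring
  have hq_lim : Tendsto q atTop (nhds 0) :=
    tendsto_zero_of_relative_deviation_ode ha_nonneg ha_le
      ((eventually_gt_atTop r₀).mono hq_deriv)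
  have hq_one : Tendsto (fun r => 1 + q r) atTop (nhds 1) := by
    simpa using hq_lim.const_add 1
  have hp_lim : Tendsto (fun r => r ^ 2 * q r) atTop (nhds (-(4 / lam) / (4 / lam - 1))) := by
    refine tendsto_of_euler_ode (A := fun r => a r * (1 + q r) ^ 2 - 1)
      (B := fun r => a r * (1 + q r)) (sub_pos.2 ((one_lt_div hlam).2 hlam4)) ?_ ?_ ?_
    · simpa using (ha_lim.mul (hq_one.pow 2)).sub_const 1
    · simpa using ha_lim.mul hq_one
    · filter_upwards [eventually_gt_atTop r₀] with r hr
      have hr0 : 0 < r := hr₀.trans hr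
      refine ((hasDerivAt_pow 2 r).mul (hq_deriv r hr)).congr_deriv ?_
      field_simp
      push_cast
      ring
  have hmain : Tendsto (fun r => r * (ψ r - r / s)) atTop (nhds (-4 / (s * (4 - lam)))) := by
    have h := hp_lim.div_const s
    have hval : -(4 / lam) / (4 / lam - 1) / s = -4 / (s * (4 - lam)) := by
      have h₁ : 4 - lam ≠ 0 := (sub_pos.2 hlam4).ne'
      rw [show 4 / lam - 1 = (4 - lam) / lam by field_simp]
      field_simp
    rw [hval] at h
    refine h.congr' ?_
    filter_upwards [eventually_gt_atTop 0] with r hr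
    simp only [hq_def]
    field_simp
  refine ⟨hmain, fun φ hφ => tendsto_div_log_of_tendsto_mul_deriv ?_ hmain⟩
  filter_upwards [eventually_gt_atTop r₀] with r hr
  refine ((hφ r hr).sub ((hasDerivAt_pow 2 r).div_const (2 * s))).congr_deriv ?_
  field_simp
  push_cast
  ring
end

section
/- Let λ = 4 and r₀ > 1, and let ψ : (r₀, ∞) → ℝ be differentiable with ψ'(r) = 1/2 + (4ψ(r)/(r(4r² + 4)))·( 2·r·ψ(r) − 1 − 4·ψ(r)² ) for all r > r₀. Then r·(ψ(r) − r/2)/log(r) tends to −1/2 as r → ∞. Consequently φ(r) = ∫ψ satisfies φ(r) − r²/4 ~ −(1/4)·log²(r) as r → ∞, where r²/4 = r²/(2√λ) is the leading quadratic term. -/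
open Real Filter Set

theorem eventually_le_mul_of_deriv_le_mul {f f' g g' : ℝ → ℝ} {c d : ℝ}
    (hf : ∀ᶠ x in atTop, HasDerivAt f (f' x) x) (hg : ∀ᶠ x in atTop, HasDerivAt g (g' x) x)
    (hle : ∀ᶠ x in atTop, f' x ≤ c * g' x) (hgtop : Tendsto g atTop atTop) (hcd : c < d) :
    ∀ᶠ x in atTop, f x ≤ d * g x := by
  obtain ⟨R, hR⟩ := eventually_atTop.1 (hf.and (hg.and hle))
  have hderiv : ∀ x, R ≤ x → HasDerivAt (fun x => f x - c * g x) (f' x - c * g' x) x :=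
    fun x hx => (hR x hx).1.sub ((hR x hx).2.1.const_mul c)
  have hanti : AntitoneOn (fun x => f x - c * g x) (Ici R) := by
    refine antitoneOn_of_deriv_nonpos (convex_Ici R)
      (fun x hx => (hderiv x hx).continuousAt.continuousWithinAt)
      (fun x hx => (hderiv x (interior_subset hx)).differentiableAt.differentiableWithinAt)
      (fun x hx => ?_)
    rw [(hderiv x (interior_subset hx)).deriv]
    linarith [(hR x (interior_subset hx)).2.2]
  filter_upwards [eventually_ge_atTop R,
    (hgtop.const_mul_atTop (sub_pos.2 hcd)).eventually_ge_atTop (f R - c * g R)] with x hx hgx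
  have h := hanti self_mem_Ici hx hx
  simp only at h
  linarith

/-- The quotient rule for limits at `atTop` when the denominator tends to infinity. -/
theorem tendsto_div_of_tendsto_deriv_div {f f' g g' : ℝ → ℝ} {L : ℝ}
    (hf : ∀ᶠ x in atTop, HasDerivAt f (f' x) x) (hg : ∀ᶠ x in atTop, HasDerivAt g (g' x) x)
    (hg' : ∀ᶠ x in atTop, 0 < g' x) (hgtop : Tendsto g atTop atTop)
    (hlim : Tendsto (fun x => f' x / g' x) atTop (nhds L)) :
    Tendsto (fun x => f x / g x) atTop (nhds L) := by
  refine tendsto_order.2 ⟨fun a ha => ?_, fun a ha => ?_⟩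
  · obtain ⟨b, hab, hbL⟩ := exists_between ha
    obtain ⟨c, hbc, hcL⟩ := exists_between hbL
    have hle : ∀ᶠ x in atTop, -f' x ≤ -c * g' x := by
      filter_upwards [hg', hlim.eventually (lt_mem_nhds hcL)] with x hx hcx
      linarith [(lt_div_iff₀ hx).1 hcx]
    filter_upwards [eventually_le_mul_of_deriv_le_mul (f := fun x => -f x)
      (hf.mono fun x hx => hx.neg) hg hle hgtop (neg_lt_neg hbc),
      hgtop.eventually_gt_atTop 0] with x hx hgx
    refine hab.trans_le ((le_div_iff₀ hgx).2 ?_)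
    linarith
  · obtain ⟨b, hLb, hba⟩ := exists_between ha
    obtain ⟨c, hLc, hcb⟩ := exists_between hLb
    have hle : ∀ᶠ x in atTop, f' x ≤ c * g' x := by
      filter_upwards [hg', hlim.eventually (gt_mem_nhds hLc)] with x hx hcx
      exact ((div_lt_iff₀ hx).1 hcx).le
    filter_upwards [eventually_le_mul_of_deriv_le_mul hf hg hle hgtop hcb,
      hgtop.eventually_gt_atTop 0] with x hx hgx
    exact ((div_le_iff₀ hgx).2 hx).trans_lt hba

/-- A solution of a scalar equation with an integrable forcing term and a damping term is
bounded. -/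
theorem exists_abs_le_of_deriv_eq_damped {q b : ℝ → ℝ} {R : ℝ} (hR : 0 < R)
    (hb : ∀ r, R ≤ r → 0 ≤ b r)
    (hq : ∀ r, R ≤ r → HasDerivAt q (-(1 / 2) / (r ^ 2 + 1) - b r * q r) r) :
    ∃ M, ∀ r, R ≤ r → |q r| ≤ M := by
  have hderiv : ∀ r, R ≤ r → HasDerivAt (fun r => log (1 + q r ^ 2) + r⁻¹)
      (2 * q r * (-(1 / 2) / (r ^ 2 + 1) - b r * q r) / (1 + q r ^ 2) + -(r ^ 2)⁻¹) r := by
    intro r hr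
    have h := ((((hq r hr).fun_pow 2).const_add 1).log (by positivity)).fun_add
      (hasDerivAt_inv (hR.trans_le hr).ne')
    exact h.congr_deriv (by norm_num)
  have hanti : AntitoneOn (fun r => log (1 + q r ^ 2) + r⁻¹) (Ici R) := by
    refine antitoneOn_of_deriv_nonpos (convex_Ici R)
      (fun x hx => (hderiv x hx).continuousAt.continuousWithinAt)
      (fun x hx => (hderiv x (interior_subset hx)).differentiableAt.differentiableWithinAt)
      (fun r hr => ?_)
    have hr' : R ≤ r := interior_subset hr
    have hr0 : 0 < r := hR.trans_le hr'
    rw [(hderiv r hr').deriv]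
    have h1 : 2 * q r * (-(1 / 2) / (r ^ 2 + 1) - b r * q r) ≤
        (1 + q r ^ 2) * (r ^ 2 + 1)⁻¹ := by
      have h2 := mul_nonneg (hb r hr') (sq_nonneg (q r))
      have h3 : 0 < (r ^ 2 + 1)⁻¹ := by positivity
      have h4 : 0 ≤ (1 + q r + q r ^ 2) * (r ^ 2 + 1)⁻¹ :=
        mul_nonneg (by nlinarith [sq_nonneg (q r + 1)]) h3.le
      rw [div_eq_mul_inv]
      linarith
    have h5 : (r ^ 2 + 1)⁻¹ ≤ (r ^ 2)⁻¹ := inv_anti₀ (by positivity) (by linarith)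
    have h6 : 2 * q r * (-(1 / 2) / (r ^ 2 + 1) - b r * q r) / (1 + q r ^ 2) ≤
        (r ^ 2 + 1)⁻¹ := by
      rw [div_le_iff₀ (by positivity)]
      linarith
    linarith
  refine ⟨exp (log (1 + q R ^ 2) + R⁻¹), fun r hr => ?_⟩
  have h := hanti self_mem_Ici hr hr
  simp only at h
  have hr0 : 0 < r⁻¹ := inv_pos.2 (hR.trans_le hr)
  have h1 : 1 + q r ^ 2 ≤ exp (log (1 + q R ^ 2) + R⁻¹) :=
    (log_le_iff_le_exp (by positivity)).1 (by linarith)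
  nlinarith [sq_nonneg (|q r| - 1), sq_abs (q r), abs_nonneg (q r)]

theorem tendsto_inv_sq_add_one_atTop :
    Tendsto (fun r : ℝ => (r ^ 2 + 1)⁻¹) atTop (nhds 0) :=
  tendsto_inv_atTop_zero.comp
    (tendsto_atTop_add_const_right _ _ (tendsto_pow_atTop two_ne_zero))

theorem tendsto_id_mul_inv_sq_add_one_atTop :
    Tendsto (fun r : ℝ => r * (r ^ 2 + 1)⁻¹) atTop (nhds 0) := by
  refine squeeze_zero' ?_ ?_ tendsto_inv_atTop_zero
  · filter_upwards [eventually_gt_atTop 0] with r hr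
    positivity
  · filter_upwards [eventually_gt_atTop 0] with r hr
    rw [← div_eq_mul_inv, div_le_iff₀ (by positivity)]
    field_simp
    linarith



/-- Asymptotics of the rotationally invariant translator in `(Nil₃, g_λ)` for `λ = 4`:
`r·(ψ(r) − r/2)/log r → −1/2`, hence any antiderivative `φ` of `ψ` satisfies
`φ(r) − r²/4 ~ −(1/4)·log²(r)` as `r → ∞`. -/
theorem rotational_translator_asymptotics_lam_eq_four
    (r₀ : ℝ) (hr₀ : 1 < r₀) (ψ : ℝ → ℝ)
    (hψ : ∀ r : ℝ, r₀ < r →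
      HasDerivAt ψ
        (1 / 2 +
          (4 * ψ r / (r * (4 * r ^ 2 + 4))) *
            (2 * r * ψ r - 1 - 4 * (ψ r) ^ 2)) r) :
    Filter.Tendsto (fun r : ℝ => r * (ψ r - r / 2) / Real.log r) Filter.atTop
      (nhds (-(1 / 2))) ∧
    ∀ φ : ℝ → ℝ, (∀ r : ℝ, r₀ < r → HasDerivAt φ (ψ r) r) →
      Filter.Tendsto (fun r : ℝ => (φ r - r ^ 2 / 4) / (Real.log r) ^ 2) Filter.atTop
        (nhds (-(1 / 4))) := by
  set q : ℝ → ℝ := fun r => ψ r - r / 2 with hqdef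
  have hr₀pos : 0 < r₀ := by linarith
  have hq : ∀ r, r₀ < r → HasDerivAt q (-(1 / 2) / (r ^ 2 + 1) -
      (1 + 4 * ψ r ^ 2) / (r * (r ^ 2 + 1)) * q r) r := by
    intro r hr
    have hr0 : 0 < r := hr₀pos.trans hr
    refine ((hψ r hr).fun_sub ((hasDerivAt_id' r).div_const 2)).congr_deriv ?_
    simp only [hqdef]
    field_simp
    ring
  have hη : ∀ r, r₀ < r → HasDerivAt (fun r => r * q r)
      (-((1 / 2 + 4 * q r ^ 2) * (r * (r ^ 2 + 1)⁻¹) + 4 * q r ^ 3 * (r ^ 2 + 1)⁻¹)) r := by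
    intro r hr
    have hr0 : 0 < r := hr₀pos.trans hr
    refine ((hasDerivAt_id' r).fun_mul (hq r hr)).congr_deriv ?_
    have hψq : ψ r = r / 2 + q r := by simp only [hqdef]; ring
    rw [hψq]
    field_simp
    ring
  obtain ⟨M, hM⟩ := exists_abs_le_of_deriv_eq_damped (R := r₀ + 1) (by linarith)
    (fun r hr => by
      have hr0 : 0 < r := by linarith
      positivity)
    (fun r hr => hq r (by linarith))
  have hη_ev := (eventually_gt_atTop r₀).mono hη
  have hq_lim : Tendsto q atTop (nhds 0) := by
    have hη' : Tendsto (fun r => -((1 / 2 + 4 * q r ^ 2) * (r * (r ^ 2 + 1)⁻¹) +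
        4 * q r ^ 3 * (r ^ 2 + 1)⁻¹) / 1) atTop (nhds 0) := by
      have hbound : Tendsto (fun r : ℝ => (1 / 2 + 4 * M ^ 2) * (r * (r ^ 2 + 1)⁻¹) +
          4 * M ^ 3 * (r ^ 2 + 1)⁻¹) atTop (nhds 0) := by
        simpa using (tendsto_id_mul_inv_sq_add_one_atTop.const_mul (1 / 2 + 4 * M ^ 2)).add
          (tendsto_inv_sq_add_one_atTop.const_mul (4 * M ^ 3))
      refine squeeze_zero_norm' ?_ hbound
      filter_upwards [eventually_ge_atTop (r₀ + 1)] with r hr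
      have hr0 : 0 < r := by linarith
      rw [div_one, norm_neg, Real.norm_eq_abs]
      refine (abs_add_le _ _).trans ?_
      have h1 : |1 / 2 + 4 * q r ^ 2| = 1 / 2 + 4 * |q r| ^ 2 := by
        rw [sq_abs, abs_of_nonneg (by positivity)]
      have h2 : |4 * q r ^ 3| = 4 * |q r| ^ 3 := by
        rw [abs_mul, abs_pow, abs_of_pos (by norm_num)]
      rw [abs_mul, abs_mul (4 * q r ^ 3), h1, h2,
        abs_of_pos (show 0 < r * (r ^ 2 + 1)⁻¹ by positivity),
        abs_of_pos (show 0 < (r ^ 2 + 1)⁻¹ by positivity)]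
      have := hM r hr
      gcongr
    refine (tendsto_div_of_tendsto_deriv_div hη_ev
      (Eventually.of_forall fun x => hasDerivAt_id' x) (by simp) tendsto_id hη').congr' ?_
    filter_upwards [eventually_gt_atTop 0] with r hr
    field_simp
  have hη_lim : Tendsto (fun r => r * q r / log r) atTop (nhds (-(1 / 2))) := by
    refine tendsto_div_of_tendsto_deriv_div hη_ev
      ((eventually_gt_atTop 0).mono fun x hx => hasDerivAt_log hx.ne')
      ((eventually_gt_atTop 0).mono fun x hx => inv_pos.2 hx) tendsto_log_atTop ?_
    have hlim := ((((hq_lim.pow 2).const_mul 4).const_add (1 / 2)).mul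
      (tendsto_inv_sq_add_one_atTop.const_sub 1)).add
      (((hq_lim.pow 3).const_mul 4).mul tendsto_id_mul_inv_sq_add_one_atTop) |>.neg
    norm_num at hlim
    norm_num
    refine hlim.congr' ?_
    filter_upwards [eventually_gt_atTop 0] with r hr
    field_simp
    ring
  refine ⟨hη_lim, fun φ hφ => ?_⟩
  refine tendsto_div_of_tendsto_deriv_div (f' := q) (g' := fun r => 2 * log r * r⁻¹)
    ?_ ?_ ?_ ((tendsto_pow_atTop two_ne_zero).comp tendsto_log_atTop) ?_
  · filter_upwards [eventually_gt_atTop r₀] with r hr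
    refine ((hφ r hr).fun_sub ((hasDerivAt_pow 2 r).div_const 4)).congr_deriv ?_
    simp only [hqdef]
    norm_num
    ring
  · filter_upwards [eventually_gt_atTop 0] with r hr
    simpa using (hasDerivAt_log hr.ne').fun_pow 2
  · filter_upwards [eventually_gt_atTop 1] with r hr
    have := log_pos hr
    positivity
  · have h := hη_lim.div_const 2
    norm_num at h ⊢
    refine h.congr' ?_
    filter_upwards [eventually_gt_atTop 1] with r hr
    have := log_pos hr
    field_simp
end

section
/- Fix λ > 4 and r₀ > 0, and let ψ : (r₀, ∞) → ℝ be differentiable with ψ'(r) = 1/√λ + (4ψ(r)/(r(λr² + 4)))·( √λ·r·ψ(r) − 1 − λ·ψ(r)² ) for all r > r₀. Then there exists a constant C₀ ∈ ℝ (depending on the solution) such that r^{4/λ}·(ψ(r) − r/√λ) tends to C₀ as r → ∞. Consequently φ(r) = ∫ψ satisfies φ(r) ≈ r²/(2√λ) + C₀'·r^{1 − 4/λ} as r → ∞ for some constant C₀' depending on the initial datum. -/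
open Real Filter Set

/-- A function whose derivative is dominated by an integrable power has a limit at infinity. -/
lemma exists_tendsto_atTop_of_abs_deriv_le_rpow {f f' : ℝ → ℝ} {R K b : ℝ} (hR : 0 < R)
    (hb : b < -1) (hf : ∀ r, R < r → HasDerivAt f (f' r) r)
    (hf' : ∀ r, R < r → |f' r| ≤ K * r ^ b) :
    ∃ c, Tendsto f atTop (nhds c) := by
  have hderiv : ∀ r ∈ Ioi R, HasDerivAt f (deriv f r) r := fun r hr =>
    (hf r hr).differentiableAt.hasDerivAt
  refine ⟨_, MeasureTheory.tendsto_limUnder_of_hasDerivAt_of_integrableOn_Ioi hderiv ?_⟩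
  refine ((integrableOn_Ioi_rpow_of_lt hb hR).const_mul K).mono'
    (measurable_deriv f).aestronglyMeasurable ?_
  filter_upwards [MeasureTheory.ae_restrict_mem measurableSet_Ioi] with r hr
  rw [(hf r hr).deriv]
  exact hf' r hr

/-- If `r ^ a * g r → 0` with `a < 1`, then an antiderivative `G` of `g` satisfies
`G r = o(r ^ (1 - a))`. -/
lemma tendsto_div_rpow_zero_of_hasDerivAt {G g : ℝ → ℝ} {R a : ℝ} (ha : a < 1)
    (hG : ∀ r, R < r → HasDerivAt G (g r) r)
    (hg : Tendsto (fun r : ℝ => r ^ a * g r) atTop (nhds 0)) :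
    Tendsto (fun r : ℝ => G r / r ^ (1 - a)) atTop (nhds 0) := by
  have ha' : 0 < 1 - a := by linarith
  rw [Metric.tendsto_atTop]
  intro ε hε
  set δ := ε * (1 - a) / 2 with hδ
  have hδpos : 0 < δ := by positivity
  obtain ⟨N, hN⟩ := Metric.tendsto_atTop.1 hg δ hδpos
  set T := max (max N 1) (R + 1)
  have hTN : N ≤ T := (le_max_left _ _).trans (le_max_left _ _)
  have hT1 : 1 ≤ T := (le_max_right _ _).trans (le_max_left _ _)
  have hTR : R < T := (lt_add_one R).trans_le (le_max_right _ _)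
  have hB : ∀ x, T ≤ x → HasDerivAt (fun x => |G T| + ε / 2 * x ^ (1 - a))
      (ε / 2 * ((1 - a) * x ^ (1 - a - 1))) x := fun x hx =>
    ((Real.hasDerivAt_rpow_const (Or.inl (by linarith))).const_mul _).const_add _
  have hbound : ∀ r, T ≤ r → |G r| ≤ |G T| + ε / 2 * r ^ (1 - a) := by
    intro r hr
    refine image_norm_le_of_norm_deriv_right_le_deriv_boundary' (a := T) (b := r)
      (f := G) (f' := g) (B := fun x => |G T| + ε / 2 * x ^ (1 - a))
      (B' := fun x => ε / 2 * ((1 - a) * x ^ (1 - a - 1))) ?_ ?_ ?_ ?_ ?_ ?_ ⟨hr, le_rfl⟩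
    · exact fun x hx => (hG x (hTR.trans_le hx.1)).continuousAt.continuousWithinAt
    · exact fun x hx => (hG x (hTR.trans_le hx.1)).hasDerivWithinAt
    · have : 0 ≤ T ^ (1 - a) := by positivity
      rw [Real.norm_eq_abs]
      nlinarith
    · exact fun x hx => (hB x hx.1).continuousAt.continuousWithinAt
    · exact fun x hx => (hB x hx.1).hasDerivWithinAt
    · intro x hx
      have hx0 : 0 < x := by linarith [hx.1]
      have h := hN x (hTN.trans hx.1)
      rw [Real.dist_eq, sub_zero, abs_mul, abs_of_pos (rpow_pos_of_pos hx0 a)] at h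
      have hxa : 0 < x ^ (-a) := rpow_pos_of_pos hx0 _
      have hinv : x ^ (-a) * x ^ a = 1 := by rw [← rpow_add hx0]; simp
      rw [show 1 - a - 1 = -a by ring, Real.norm_eq_abs]
      calc |g x| = x ^ (-a) * (x ^ a * |g x|) := by rw [← mul_assoc, hinv, one_mul]
        _ ≤ x ^ (-a) * δ := by gcongr
        _ = ε / 2 * ((1 - a) * x ^ (-a)) := by rw [hδ]; ring
  obtain ⟨N', hN'⟩ := Filter.eventually_atTop.1
    ((tendsto_rpow_atTop ha').eventually_gt_atTop (2 * |G T| / ε))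
  refine ⟨max T N', fun r hr => ?_⟩
  have hr0 : 0 < r := by linarith [(le_max_left T N').trans hr]
  have hp : 0 < r ^ (1 - a) := rpow_pos_of_pos hr0 _
  have h₁ := hbound r ((le_max_left _ _).trans hr)
  have h₂ := hN' r ((le_max_right _ _).trans hr)
  rw [div_lt_iff₀ hε] at h₂
  rw [Real.dist_eq, sub_zero, abs_div, abs_of_pos hp, div_lt_iff₀ hp]
  linarith

/-- L'Hôpital's rule against the power `r ^ (1 - a)`, `a < 1`. -/
lemma tendsto_div_rpow_of_hasDerivAt {G g : ℝ → ℝ} {R a c : ℝ} (hR : 0 < R) (ha : a < 1)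
    (hG : ∀ r, R < r → HasDerivAt G (g r) r)
    (hg : Tendsto (fun r : ℝ => r ^ a * g r) atTop (nhds c)) :
    Tendsto (fun r : ℝ => G r / r ^ (1 - a)) atTop (nhds (c / (1 - a))) := by
  have ha' : 1 - a ≠ 0 := by linarith
  have key := tendsto_div_rpow_zero_of_hasDerivAt (R := R) ha
    (G := fun r => G r - c / (1 - a) * r ^ (1 - a)) (g := fun r => g r - c * r ^ (-a)) ?_ ?_
  · have h := key.add_const (c / (1 - a))
    rw [zero_add] at h
    refine h.congr' ?_
    filter_upwards [eventually_gt_atTop 0] with r hr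
    have hp : r ^ (1 - a) ≠ 0 := (rpow_pos_of_pos hr _).ne'
    field_simp
    ring
  · intro r hr
    have h := (hG r hr).sub
      ((Real.hasDerivAt_rpow_const (p := 1 - a) (Or.inl (hR.trans hr).ne')).const_mul
        (c / (1 - a)))
    refine HasDerivAt.congr_deriv h ?_
    rw [show 1 - a - 1 = -a by ring]
    field_simp
  · have h := hg.sub_const c
    rw [sub_self] at h
    refine h.congr' ?_
    filter_upwards [eventually_gt_atTop 0] with r hr
    have hinv : r ^ a * r ^ (-a) = 1 := by rw [← rpow_add hr]; simp
    linear_combination c * hinv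

/-- The right-hand side of the translator equation in the unknown `u = ψ - r / s`, `s = √λ`. -/
noncomputable def translatorDeviationField (s r u : ℝ) : ℝ :=
  -(4 * (u + r / s) / (r * (s ^ 2 * r ^ 2 + 4))) * (1 + s * r * u + s ^ 2 * u ^ 2)

lemma two_mul_mul_translatorDeviationField_le {s r : ℝ} (hs : 0 < s) (hr : 0 < r) (u : ℝ) :
    2 * u * translatorDeviationField s r u ≤ 2 / (s ^ 4 * r ^ 3) := by
  have hE : 2 * u * translatorDeviationField s r u
      = 8 / (s ^ 2 * r * (s ^ 2 * r ^ 2 + 4)) *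
        -((s * r * u + s ^ 2 * u ^ 2) * (1 + (s * r * u + s ^ 2 * u ^ 2))) := by
    unfold translatorDeviationField
    field_simp
    ring
  rw [hE]
  calc _ ≤ 8 / (s ^ 2 * r * (s ^ 2 * r ^ 2 + 4)) * (1 / 4) := by
        gcongr
        nlinarith [sq_nonneg (2 * (s * r * u + s ^ 2 * u ^ 2) + 1)]
    _ ≤ 8 / (s ^ 2 * r * (s ^ 2 * r ^ 2)) * (1 / 4) := by
        gcongr
        linarith
    _ = 2 / (s ^ 4 * r ^ 3) := by
        field_simp
        norm_num

/-- The deviation `u = ψ - r / s` stays bounded, since `u² + 1 / (s⁴ r²)` is nonincreasing. -/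
lemma exists_abs_le_of_translatorDeviation {s r₀ : ℝ} {u : ℝ → ℝ} (hs : 0 < s) (hr₀ : 0 < r₀)
    (hu : ∀ r, r₀ < r → HasDerivAt u (translatorDeviationField s r (u r)) r) :
    ∃ M, ∀ r, r₀ + 1 < r → |u r| ≤ M := by
  have hderiv : ∀ r, r₀ < r → HasDerivAt (fun x => u x ^ 2 + 1 / s ^ 4 * (x ^ 2)⁻¹)
      (2 * u r * translatorDeviationField s r (u r) - 2 / (s ^ 4 * r ^ 3)) r := by
    intro r hr
    have hr0 : r ≠ 0 := (hr₀.trans hr).ne'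
    have h := ((hu r hr).pow 2).add
      ((((hasDerivAt_id r).pow 2).inv (pow_ne_zero 2 hr0)).const_mul (1 / s ^ 4))
    refine HasDerivAt.congr_deriv h ?_
    simp only [id, Pi.pow_apply]
    field_simp
    ring
  have hanti : AntitoneOn (fun x => u x ^ 2 + 1 / s ^ 4 * (x ^ 2)⁻¹) (Ioi r₀) := by
    refine antitoneOn_of_deriv_nonpos (convex_Ioi r₀)
      (fun r hr => (hderiv r hr).continuousAt.continuousWithinAt) ?_ ?_
    · rw [interior_Ioi]
      exact fun r hr => (hderiv r hr).differentiableAt.differentiableWithinAt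
    · rw [interior_Ioi]
      intro r hr
      rw [(hderiv r hr).deriv, sub_nonpos]
      exact two_mul_mul_translatorDeviationField_le hs (hr₀.trans hr) _
  refine ⟨u (r₀ + 1) ^ 2 + 1 / s ^ 4 * ((r₀ + 1) ^ 2)⁻¹ + 1, fun r hr => ?_⟩
  have h := hanti (mem_Ioi.2 (lt_add_one r₀)) (mem_Ioi.2 ((lt_add_one r₀).trans hr)) hr.le
  have hpos : 0 ≤ 1 / s ^ 4 * (r ^ 2)⁻¹ := by positivity
  simp only at h
  rw [← sq_abs (u r)] at h
  nlinarith [sq_nonneg (|u r| - 1), abs_nonneg (u r)]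

/-- The linear part of the deviation field at infinity is `-(4 / s²) u / r`,
up to `O(r⁻²)` for bounded `u`. -/
lemma abs_translatorDeviationField_add_le {s r u M : ℝ} (hs : 0 < s) (hr : 1 ≤ r)
    (hu : |u| ≤ M) :
    |translatorDeviationField s r u + 4 / s ^ 2 * u / r| ≤
      (16 * M / s ^ 4 + 4 * (s ^ 2 * M ^ 3 + 2 * s * M ^ 2 + M + 1 / s) / s ^ 2) / r ^ 2 := by
  have hr0 : 0 < r := by linarith
  have hM : 0 ≤ M := (abs_nonneg u).trans hu
  have hE : translatorDeviationField s r u + 4 / s ^ 2 * u / r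
      = 16 * u / (s ^ 2 * r * (s ^ 2 * r ^ 2 + 4))
        - 4 * (s ^ 2 * u ^ 3 + 2 * s * r * u ^ 2 + u + r / s) / (r * (s ^ 2 * r ^ 2 + 4)) := by
    unfold translatorDeviationField
    field_simp
    ring
  have hD : s ^ 2 * r ^ 2 ≤ s ^ 2 * r ^ 2 + 4 := by linarith
  have h₁ : |16 * u / (s ^ 2 * r * (s ^ 2 * r ^ 2 + 4))| ≤ 16 * M / s ^ 4 / r ^ 2 := by
    rw [abs_div, abs_mul, abs_of_pos (by positivity : 0 < s ^ 2 * r * (s ^ 2 * r ^ 2 + 4)),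
      abs_of_pos (by norm_num : (0 : ℝ) < 16), div_div]
    refine div_le_div₀ (by positivity) (by gcongr) (by positivity) ?_
    calc s ^ 4 * r ^ 2 = s ^ 2 * 1 * (s ^ 2 * r ^ 2) := by ring
      _ ≤ s ^ 2 * r * (s ^ 2 * r ^ 2 + 4) := by gcongr
  have h₂ : |4 * (s ^ 2 * u ^ 3 + 2 * s * r * u ^ 2 + u + r / s) / (r * (s ^ 2 * r ^ 2 + 4))|
      ≤ 4 * (s ^ 2 * M ^ 3 + 2 * s * M ^ 2 + M + 1 / s) / s ^ 2 / r ^ 2 := by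
    have hnum : |s ^ 2 * u ^ 3 + 2 * s * r * u ^ 2 + u + r / s|
        ≤ r * (s ^ 2 * M ^ 3 + 2 * s * M ^ 2 + M + 1 / s) := by
      calc _ ≤ |s ^ 2 * u ^ 3| + |2 * s * r * u ^ 2| + |u| + |r / s| := by
            refine (abs_add_le _ _).trans ?_
            gcongr
            refine (abs_add_le _ _).trans ?_
            gcongr
            exact abs_add_le _ _
        _ = s ^ 2 * |u| ^ 3 + 2 * s * r * |u| ^ 2 + |u| + r / s := by
            simp only [abs_mul, abs_pow, abs_div, abs_of_pos hs, abs_of_pos hr0, abs_two]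
        _ ≤ s ^ 2 * M ^ 3 + 2 * s * r * M ^ 2 + M + r / s := by gcongr
        _ ≤ r * (s ^ 2 * M ^ 3) + 2 * s * r * M ^ 2 + r * M + r / s := by
            have h₃ : s ^ 2 * M ^ 3 ≤ r * (s ^ 2 * M ^ 3) :=
              le_mul_of_one_le_left (by positivity) hr
            have h₄ : M ≤ r * M := le_mul_of_one_le_left hM hr
            linarith
        _ = _ := by ring
    rw [abs_div, abs_mul, abs_of_pos (by positivity : 0 < r * (s ^ 2 * r ^ 2 + 4)),
      abs_of_pos (by norm_num : (0 : ℝ) < 4), div_div]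
    calc _ ≤ 4 * (r * (s ^ 2 * M ^ 3 + 2 * s * M ^ 2 + M + 1 / s)) / (r * (s ^ 2 * r ^ 2)) := by
          gcongr
      _ = _ := by
          field_simp
  rw [hE, add_div]
  exact (abs_sub _ _).trans (add_le_add h₁ h₂)

/-- If `4 < s²`, the deviation satisfies `u ~ C₀ r ^ (-4 / s²)` at infinity. -/
lemma exists_tendsto_rpow_mul_of_translatorDeviation {s r₀ : ℝ} {u : ℝ → ℝ} (hs : 0 < s)
    (hs4 : 4 < s ^ 2) (hr₀ : 0 < r₀)
    (hu : ∀ r, r₀ < r → HasDerivAt u (translatorDeviationField s r (u r)) r) :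
    ∃ C₀, Tendsto (fun r : ℝ => r ^ (4 / s ^ 2) * u r) atTop (nhds C₀) := by
  obtain ⟨M, hM⟩ := exists_abs_le_of_translatorDeviation hs hr₀ hu
  have ha : 4 / s ^ 2 < 1 := (div_lt_one (by positivity)).2 hs4
  set a := 4 / s ^ 2
  refine exists_tendsto_atTop_of_abs_deriv_le_rpow (R := r₀ + 1) (b := a - 2)
    (K := 16 * M / s ^ 4 + 4 * (s ^ 2 * M ^ 3 + 2 * s * M ^ 2 + M + 1 / s) / s ^ 2)
    (f' := fun r => r ^ a * (translatorDeviationField s r (u r) + a * u r / r))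
    (by linarith) (by linarith) ?_ ?_
  · intro r hr
    have hr0 : 0 < r := by linarith
    have h := (Real.hasDerivAt_rpow_const (p := a) (Or.inl hr0.ne')).mul (hu r (by linarith))
    refine HasDerivAt.congr_deriv h ?_
    rw [rpow_sub_one hr0.ne']
    field_simp
    ring
  · intro r hr
    have hr0 : 0 < r := by linarith
    rw [abs_mul, abs_of_pos (rpow_pos_of_pos hr0 a), rpow_sub hr0, rpow_two]
    calc _ ≤ r ^ a * _ := mul_le_mul_of_nonneg_left
          (abs_translatorDeviationField_add_le hs (by linarith) (hM r hr)) (by positivity)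
      _ = _ := by ring

/-- Asymptotics of the rotationally invariant translator in `(Nil₃, g_λ)` for `λ > 4`:
`r^{4/λ}·(ψ(r) − r/√λ)` converges to some constant `C₀`, hence any antiderivative `φ`
of `ψ` satisfies `φ(r) ≈ r²/(2√λ) + C₀'·r^{1−4/λ}` as `r → ∞`. -/
theorem rotational_translator_asymptotics_lam_gt_four
    (lam r₀ : ℝ) (hlam : 4 < lam) (hr₀ : 0 < r₀) (ψ : ℝ → ℝ)
    (hψ : ∀ r : ℝ, r₀ < r →
      HasDerivAt ψ
        (1 / Real.sqrt lam +
          (4 * ψ r / (r * (lam * r ^ 2 + 4))) *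
            (Real.sqrt lam * r * ψ r - 1 - lam * (ψ r) ^ 2)) r) :
    (∃ C₀ : ℝ, Filter.Tendsto
      (fun r : ℝ => r ^ ((4 : ℝ) / lam) * (ψ r - r / Real.sqrt lam)) Filter.atTop
      (nhds C₀)) ∧
    ∀ φ : ℝ → ℝ, (∀ r : ℝ, r₀ < r → HasDerivAt φ (ψ r) r) →
      ∃ C₀' : ℝ, Filter.Tendsto
        (fun r : ℝ => (φ r - r ^ 2 / (2 * Real.sqrt lam)) / r ^ (1 - (4 : ℝ) / lam))
        Filter.atTop (nhds C₀') := by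
  obtain ⟨s, hs, rfl⟩ : ∃ s : ℝ, 0 < s ∧ lam = s ^ 2 :=
    ⟨√lam, Real.sqrt_pos.2 (by linarith), (Real.sq_sqrt (by linarith)).symm⟩
  rw [Real.sqrt_sq hs.le] at hψ ⊢
  have ha : 4 / s ^ 2 < 1 := (div_lt_one (by positivity)).2 hlam
  have hu : ∀ r, r₀ < r → HasDerivAt (fun r => ψ r - r / s)
      (translatorDeviationField s r (ψ r - r / s)) r := by
    intro r hr
    have hr0 : r ≠ 0 := (hr₀.trans hr).ne'
    refine ((hψ r hr).sub ((hasDerivAt_id r).div_const s)).congr_deriv ?_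
    unfold translatorDeviationField
    field_simp
    ring
  obtain ⟨C₀, hC₀⟩ := exists_tendsto_rpow_mul_of_translatorDeviation hs hlam hr₀ hu
  refine ⟨⟨C₀, hC₀⟩, fun φ hφ => ⟨C₀ / (1 - 4 / s ^ 2), ?_⟩⟩
  refine tendsto_div_rpow_of_hasDerivAt (G := fun r => φ r - r ^ 2 / (2 * s)) hr₀ ha ?_ hC₀
  intro r hr
  refine ((hφ r hr).sub (((hasDerivAt_id r).pow 2).div_const (2 * s))).congr_deriv ?_
  simp only [id]
  field_simp
  ring
end

section
/- Fix f₀ > 0 and define f̃(z) = √(4z² + f₀⁴)/f₀. For every m ∈ ℕ and every compact set K ⊂ ℝ there exist λ₀ > 0 and C > 0 (depending only on K, m, f₀) such that for all λ ≥ λ₀ the following holds: if f is a smooth function defined on an open interval containing K ∪ {0} satisfying f(0) = f₀, f'(0) = 0, and f''(z) = (4/(√λ·f(z)·(4 + λ·f(z)²)))·( λ^{3/2} + √λ·f'(z)² − f(z)·f'(z)³ − λ·f(z)·f'(z) − (λ/4)·f(z)³·f'(z)³ ) for all z in that interval, then |f^{(m)}(z) − f̃^{(m)}(z)| ≤ C·λ^{-1/2}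 for all z ∈ K. -/
open Real Filter Set

/-- Grönwall's inequality for two trajectories of an autonomous vector field that is Lipschitz
on a tube around the second one: the first trajectory cannot leave the tube when the initial
distance is small enough. -/
theorem dist_le_of_trajectories_of_tube {E : Type*} [NormedAddCommGroup E] [NormedSpace ℝ E]
    {V : E → E} {S : Set E} {L : NNReal} (hV : LipschitzOnWith L V S) {u v : ℝ → E}
    {r T δ : ℝ} (hT : 0 ≤ T) (hδ : 0 ≤ δ)
    (hu : ∀ t ∈ Icc 0 T, HasDerivAt u (V (u t)) t)
    (hv : ∀ t ∈ Icc 0 T, HasDerivAt v (V (v t)) t)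
    (hS : ∀ t ∈ Icc 0 T, ∀ x, dist x (v t) < r → x ∈ S)
    (h0 : dist (u 0) (v 0) ≤ δ) (hr : δ * exp (L * T) < r) :
    dist (u T) (v T) ≤ δ * exp (L * T) := by
  have hrpos : 0 < r := lt_of_le_of_lt (by positivity) hr
  have hcu : ContinuousOn u (Icc 0 T) := fun t ht => (hu t ht).continuousAt.continuousWithinAt
  have hcv : ContinuousOn v (Icc 0 T) := fun t ht => (hv t ht).continuousAt.continuousWithinAt
  have key : ∀ t ∈ Icc 0 T, (∀ s ∈ Ico 0 t, dist (u s) (v s) < r) →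
      dist (u t) (v t) ≤ δ * exp (L * T) := by
    intro t ht hlt
    have hsub : Icc 0 t ⊆ Icc 0 T := Icc_subset_Icc_right ht.2
    have hsub' : Ico 0 t ⊆ Icc 0 T := Ico_subset_Icc_self.trans hsub
    have h := dist_le_of_trajectories_ODE_of_mem (v := fun _ => V) (s := fun _ => S) (K := L)
      (fun _ _ => hV) (hcu.mono hsub) (fun s hs => (hu s (hsub' hs)).hasDerivWithinAt)
      (fun s hs => hS s (hsub' hs) _ (hlt s hs))
      (hcv.mono hsub) (fun s hs => (hv s (hsub' hs)).hasDerivWithinAt)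
      (fun s hs => hS s (hsub' hs) _ (by rwa [dist_self])) h0 t (right_mem_Icc.2 ht.1)
    refine h.trans ?_
    have : t - 0 ≤ T := by linarith [ht.2]
    gcongr
  have hall : ∀ t ∈ Icc 0 T, dist (u t) (v t) < r := by
    by_contra! hbad
    have hclosed : IsCompact {t ∈ Icc 0 T | r ≤ dist (u t) (v t)} := by
      refine isCompact_Icc.of_isClosed_subset ?_ (sep_subset _ _)
      exact isClosed_Icc.isClosed_le continuousOn_const (continuous_dist.comp_continuousOn (hcu.prodMk hcv))
    obtain ⟨t, ⟨ht, htr⟩, hmin⟩ := hclosed.exists_isLeast hbad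
    have := key t ht fun s hs => by
      by_contra! hge
      exact absurd (hmin ⟨⟨hs.1, hs.2.le.trans ht.2⟩, hge⟩) (not_le.2 hs.2)
    linarith
  exact key T (right_mem_Icc.2 hT) fun s hs => hall s (Ico_subset_Icc_self hs)

/-- A version of `dist_le_of_trajectories_of_tube` for forward and backward times. -/
theorem dist_le_of_trajectories_of_tube_abs {E : Type*} [NormedAddCommGroup E] [NormedSpace ℝ E]
    {V : E → E} {S : Set E} {L : NNReal} (hV : LipschitzOnWith L V S) {u v : ℝ → E}
    {r z δ : ℝ} (hδ : 0 ≤ δ)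
    (hu : ∀ t ∈ uIcc 0 z, HasDerivAt u (V (u t)) t)
    (hv : ∀ t ∈ uIcc 0 z, HasDerivAt v (V (v t)) t)
    (hS : ∀ t ∈ uIcc 0 z, ∀ x, dist x (v t) < r → x ∈ S)
    (h0 : dist (u 0) (v 0) ≤ δ) (hr : δ * exp (L * |z|) < r) :
    dist (u z) (v z) ≤ δ * exp (L * |z|) := by
  rcases le_total 0 z with hz | hz
  · rw [uIcc_of_le hz] at hu hv hS
    rw [abs_of_nonneg hz] at hr ⊢
    exact dist_le_of_trajectories_of_tube hV hz hδ hu hv hS h0 hr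
  · rw [uIcc_of_ge hz] at hu hv hS
    rw [abs_of_nonpos hz] at hr ⊢
    have hmem : ∀ t ∈ Icc 0 (-z), -t ∈ Icc z 0 := fun t ht =>
      ⟨by linarith [ht.2], by linarith [ht.1]⟩
    have hneg : ∀ {w : ℝ → E}, (∀ t ∈ Icc z 0, HasDerivAt w (V (w t)) t) →
        ∀ t ∈ Icc 0 (-z), HasDerivAt (fun t => w (-t)) ((fun x => -V x) (w (-t))) t := by
      intro w hw t ht
      simpa [Function.comp_def] using (hw _ (hmem t ht)).scomp t (hasDerivAt_neg t)
    have := dist_le_of_trajectories_of_tube (V := fun x => -V x) (u := fun t => u (-t))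
      (v := fun t => v (-t)) hV.neg (neg_nonneg.2 hz) hδ (hneg hu) (hneg hv)
      (fun t ht => hS _ (hmem t ht)) (by simpa using h0) hr
    simpa using this

/-- Along trajectories of a smooth vector field, the iterated derivatives of a smooth observable
are smooth functions of the state. -/
theorem exists_iteratedDeriv_eq_of_trajectory {E : Type*} [NormedAddCommGroup E]
    [NormedSpace ℝ E] {V : E → E} {U : Set E} (hU : IsOpen U)
    (hV : ContDiffOn ℝ (⊤ : ℕ∞) V U) {h : E → ℝ} (hh : ContDiffOn ℝ (⊤ : ℕ∞) h U) (m : ℕ) :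
    ∃ H : E → ℝ, ContDiffOn ℝ (⊤ : ℕ∞) H U ∧
      ∀ (u : ℝ → E) (W : Set ℝ), IsOpen W → MapsTo u W U →
        (∀ z ∈ W, HasDerivAt u (V (u z)) z) →
        ∀ z ∈ W, iteratedDeriv m (fun z => h (u z)) z = H (u z) := by
  induction m with
  | zero => exact ⟨h, hh, fun u W _ _ _ z _ => by simp⟩
  | succ m ih =>
    obtain ⟨H, hH, hHu⟩ := ih
    refine ⟨fun x => fderiv ℝ H x (V x), ?_, fun u W hW hmap hu z hz => ?_⟩
    · exact (hH.fderiv_of_isOpen hU (by simp)).clm_apply hV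
    · have hev : iteratedDeriv m (fun z => h (u z)) =ᶠ[nhds z] fun z => H (u z) := by
        filter_upwards [hW.mem_nhds hz] with y hy using hHu u W hW hmap hu y hy
      rw [iteratedDeriv_succ, hev.deriv_eq]
      have hd : DifferentiableAt ℝ H (u z) :=
        (hH.contDiffAt (hU.mem_nhds (hmap hz))).differentiableAt (by simp)
      exact (hd.hasFDerivAt.comp_hasDerivAt z (hu z hz)).deriv

/-- The translating catenoid equation as an autonomous first order system in the variables
`(ε, f, f')`, where `ε = λ ^ (-1/2)`. -/
noncomputable def catenoidField (w : ℝ × ℝ × ℝ) : ℝ × ℝ × ℝ :=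
  (0, w.2.2, 4 / (w.2.1 * (4 * w.1 ^ 2 + w.2.1 ^ 2)) *
    (1 + w.1 ^ 2 * w.2.2 ^ 2 - w.1 ^ 3 * w.2.1 * w.2.2 ^ 3 - w.1 * w.2.1 * w.2.2
      - w.1 / 4 * w.2.1 ^ 3 * w.2.2 ^ 3))

theorem contDiffOn_catenoidField :
    ContDiffOn ℝ (⊤ : ℕ∞) catenoidField {w | 0 < w.2.1} := by
  unfold catenoidField
  refine contDiffOn_const.prodMk (ContDiffOn.prodMk (by fun_prop)
    (ContDiffOn.mul (ContDiffOn.div (by fun_prop) (by fun_prop) ?_) (by fun_prop)))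
  intro w (hw : 0 < w.2.1)
  positivity

theorem hasDerivAt_catenoid_trajectory {lam p q : ℝ} (hlam : 0 < lam) {f : ℝ → ℝ}
    (hf : ContDiffOn ℝ (⊤ : ℕ∞) f (Ioo p q))
    (hode : ∀ z ∈ Ioo p q, iteratedDeriv 2 f z =
      (4 / (√lam * f z * (4 + lam * (f z) ^ 2))) *
        ((√lam) ^ 3 + √lam * (deriv f z) ^ 2 - f z * (deriv f z) ^ 3 - lam * f z * deriv f z
          - (lam / 4) * (f z) ^ 3 * (deriv f z) ^ 3)) {z : ℝ} (hz : z ∈ Ioo p q) :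
    HasDerivAt (fun z => ((√lam)⁻¹, f z, deriv f z))
      (catenoidField ((√lam)⁻¹, f z, deriv f z)) z := by
  have hfz : HasDerivAt f (deriv f z) z :=
    ((hf.contDiffAt (isOpen_Ioo.mem_nhds hz)).differentiableAt (by simp)).hasDerivAt
  have hf' : ContDiffOn ℝ (⊤ : ℕ∞) (deriv f) (Ioo p q) :=
    hf.deriv_of_isOpen isOpen_Ioo (by simp)
  have hf'z : HasDerivAt (deriv f) (iteratedDeriv 2 f z) z := by
    rw [iteratedDeriv_succ, iteratedDeriv_one]
    exact ((hf'.contDiffAt (isOpen_Ioo.mem_nhds hz)).differentiableAt (by simp)).hasDerivAt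
  have := (hasDerivAt_const z (√lam)⁻¹).prodMk (hfz.prodMk hf'z)
  convert this using 1
  simp only [catenoidField, Prod.mk.injEq, true_and]
  rw [hode z hz]
  obtain ⟨s, hs, rfl⟩ : ∃ s : ℝ, 0 < s ∧ lam = s ^ 2 :=
    ⟨√lam, sqrt_pos.2 hlam, (sq_sqrt hlam.le).symm⟩
  rw [sqrt_sq hs.le]
  generalize deriv f z = y
  generalize f z = x
  rcases eq_or_ne x 0 with rfl | hx
  · simp
  · have h1 : 4 + s ^ 2 * x ^ 2 ≠ 0 := by positivity
    have h2 : 4 * (s⁻¹) ^ 2 + x ^ 2 = (4 + s ^ 2 * x ^ 2) / s ^ 2 := by field_simp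
    rw [h2]
    field_simp

theorem hasDerivAt_limit_trajectory {f₀ : ℝ} (hf₀ : 0 < f₀) {ftil : ℝ → ℝ}
    (hftil : ∀ z : ℝ, ftil z = √(4 * z ^ 2 + f₀ ^ 4) / f₀) (z : ℝ) :
    HasDerivAt (fun z => ((0 : ℝ), ftil z, 4 * z / (f₀ ^ 2 * ftil z)))
      (catenoidField (0, ftil z, 4 * z / (f₀ ^ 2 * ftil z))) z := by
  have hpos : 0 < 4 * z ^ 2 + f₀ ^ 4 := by positivity
  have hz : 0 < ftil z := by rw [hftil]; positivity
  have hsq : f₀ ^ 2 * ftil z ^ 2 = 4 * z ^ 2 + f₀ ^ 4 := by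
    rw [hftil, div_pow, sq_sqrt hpos.le]; field_simp
  have hd : HasDerivAt ftil (4 * z / (f₀ ^ 2 * ftil z)) z := by
    have h := (((((hasDerivAt_id z).pow 2).const_mul 4).add_const (f₀ ^ 4)).sqrt
      hpos.ne').div_const f₀
    have hfun : ftil = fun z => √(4 * z ^ 2 + f₀ ^ 4) / f₀ := funext hftil
    rw [hfun]
    refine HasDerivAt.congr_deriv h ?_
    have : √(4 * z ^ 2 + f₀ ^ 4) ≠ 0 := (sqrt_pos.2 hpos).ne'
    simp only [Pi.pow_apply, id]
    field_simp
    norm_num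
  have hd2 := ((hasDerivAt_id z).const_mul 4).div (hd.const_mul (f₀ ^ 2)) (by positivity)
  refine ((hasDerivAt_const z (0 : ℝ)).prodMk (hd.prodMk hd2)).congr_deriv ?_
  simp only [catenoidField, Prod.mk.injEq, true_and, id]
  field_simp
  linear_combination (f₀ ^ 2 * ftil z ^ 2) * hsq

theorem le_limit_profile {f₀ : ℝ} (hf₀ : 0 < f₀) (z : ℝ) :
    f₀ ≤ √(4 * z ^ 2 + f₀ ^ 4) / f₀ := by
  rw [le_div_iff₀ hf₀]
  exact le_sqrt_of_sq_le (by nlinarith [sq_nonneg z])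

/-- Uniform `C^m` convergence, on compact sets, of the profile of the translating
catenoid of `(Nil₃, g_λ)` to the explicit profile `f̃(z) = √(4z² + f₀⁴)/f₀` as `λ → ∞`. -/
theorem translating_catenoid_convergence
    (f₀ : ℝ) (hf₀ : 0 < f₀) (ftil : ℝ → ℝ)
    (hftil : ∀ z : ℝ, ftil z = Real.sqrt (4 * z ^ 2 + f₀ ^ 4) / f₀)
    (m : ℕ) (K : Set ℝ) (hK : IsCompact K) :
    ∃ lam0 > (0 : ℝ), ∃ C > (0 : ℝ), ∀ lam : ℝ, lam0 ≤ lam →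
      ∀ p q : ℝ, K ∪ {0} ⊆ Set.Ioo p q →
        ∀ f : ℝ → ℝ, ContDiffOn ℝ (⊤ : ℕ∞) f (Set.Ioo p q) →
          f 0 = f₀ → deriv f 0 = 0 →
          (∀ z ∈ Set.Ioo p q, iteratedDeriv 2 f z =
            (4 / (Real.sqrt lam * f z * (4 + lam * (f z) ^ 2))) *
              ((Real.sqrt lam) ^ 3 + Real.sqrt lam * (deriv f z) ^ 2
                - f z * (deriv f z) ^ 3 - lam * f z * deriv f z
                - (lam / 4) * (f z) ^ 3 * (deriv f z) ^ 3)) →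
          ∀ z ∈ K, |iteratedDeriv m f z - iteratedDeriv m ftil z| ≤
            C * lam ^ (-(1 / 2) : ℝ) := by
  set v : ℝ → ℝ × ℝ × ℝ := fun z => (0, ftil z, 4 * z / (f₀ ^ 2 * ftil z)) with hv_def
  have hv : ∀ z, HasDerivAt v (catenoidField (v z)) z := hasDerivAt_limit_trajectory hf₀ hftil
  have hge : ∀ z, f₀ ≤ ftil z := fun z => hftil z ▸ le_limit_profile hf₀ z
  have hcont : Continuous v := continuous_iff_continuousAt.2 fun z => (hv z).continuousAt
  obtain ⟨R, hR⟩ : ∃ R : ℝ, ∀ z ∈ K, |z| ≤ R := by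
    obtain ⟨R, hR⟩ := hK.isBounded.exists_norm_le
    exact ⟨R, fun z hz => by simpa using hR z hz⟩
  obtain ⟨M, hM⟩ : ∃ M : ℝ, ∀ z ∈ Icc (-R) R, ‖v z‖ ≤ M :=
    isCompact_Icc.exists_bound_of_continuousOn hcont.continuousOn
  set U : Set (ℝ × ℝ × ℝ) := {w | 0 < w.2.1} with hU_def
  have hU : IsOpen U := isOpen_lt continuous_const (by fun_prop)
  set S : Set (ℝ × ℝ × ℝ) := Icc (-1, f₀ / 2, -(M + 1)) (1, M + 1, M + 1) with hS_def
  have hSU : S ⊆ U := fun w hw => lt_of_lt_of_le (half_pos hf₀) hw.1.2.1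
  have hScvx : Convex ℝ S := convex_Icc _ _
  have hScpt : IsCompact S := isCompact_Icc
  obtain ⟨L, hL⟩ := (contDiffOn_catenoidField.mono hSU).exists_lipschitzOnWith
    (by simp) hScvx hScpt
  obtain ⟨H, hH, hHu⟩ := exists_iteratedDeriv_eq_of_trajectory hU contDiffOn_catenoidField
    (h := fun w => w.2.1) (by fun_prop) m
  obtain ⟨N, hN⟩ := (hH.mono hSU).exists_lipschitzOnWith (by simp) hScvx hScpt
  set r : ℝ := min 1 (f₀ / 2) with hr_def
  have hr : 0 < r := lt_min one_pos (half_pos hf₀)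
  have htube : ∀ t ∈ Icc (-R) R, ∀ x, dist x (v t) < r → x ∈ S := by
    rintro t ht ⟨a, b, c⟩ hx
    have hvM := hM t ht
    simp only [hv_def, Prod.norm_def, Prod.dist_eq, Real.dist_eq, Real.norm_eq_abs, sup_le_iff,
      max_lt_iff, hr_def, lt_min_iff, abs_le, abs_lt] at hx hvM
    have := hge t
    refine ⟨⟨?_, ?_, ?_⟩, ⟨?_, ?_, ?_⟩⟩ <;> dsimp only <;> linarith
  set A : ℝ := exp (L * R) with hA_def
  have hA : 0 < A := exp_pos _
  refine ⟨(2 * A / r) ^ 2, by positivity, N * A + 1, by positivity, ?_⟩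
  intro lam hlam p q hpq f hf hf0 hf0' hode z hz
  have hlampos : 0 < lam := lt_of_lt_of_le (by positivity) hlam
  set ε : ℝ := (√lam)⁻¹ with hε_def
  have hε : 0 < ε := inv_pos.2 (sqrt_pos.2 hlampos)
  have hεlam : lam ^ (-(1 / 2) : ℝ) = ε := by rw [rpow_neg hlampos.le, hε_def, sqrt_eq_rpow]
  have hεA : ε * A < r := by
    have h1 : 2 * A / r ≤ √lam := le_sqrt_of_sq_le hlam
    rw [div_le_iff₀ hr] at h1
    rw [hε_def, inv_mul_lt_iff₀ (sqrt_pos.2 hlampos)]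
    linarith
  set u : ℝ → ℝ × ℝ × ℝ := fun z => (ε, f z, deriv f z) with hu_def
  have hu : ∀ t ∈ Ioo p q, HasDerivAt u (catenoidField (u t)) t := fun t ht =>
    hasDerivAt_catenoid_trajectory hlampos hf hode ht
  have h0mem : (0 : ℝ) ∈ Ioo p q := hpq (by simp)
  have hzmem : z ∈ Ioo p q := hpq (Or.inl hz)
  have hsub : uIcc 0 z ⊆ Ioo p q := ordConnected_Ioo.uIcc_subset h0mem hzmem
  have hzR := hR z hz
  have hsubR : uIcc 0 z ⊆ Icc (-R) R :=
    ordConnected_Icc.uIcc_subset (abs_le.1 (by simpa using (abs_nonneg z).trans hzR))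
      (abs_le.1 hzR)
  have h0 : dist (u 0) (v 0) ≤ ε := by
    have hft0 : ftil 0 = f₀ := by
      rw [hftil, show 4 * (0 : ℝ) ^ 2 + f₀ ^ 4 = (f₀ ^ 2) ^ 2 by ring, sqrt_sq (by positivity)]
      field_simp
    simp [hu_def, hv_def, hf0, hf0', hft0, Prod.dist_eq, abs_of_pos hε, hε.le]
  have hexp : ε * exp (L * |z|) ≤ ε * A := by rw [hA_def]; gcongr
  have hdist : dist (u z) (v z) ≤ ε * A :=
    (dist_le_of_trajectories_of_tube_abs hL hε.le (fun t ht => hu t (hsub ht))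
      (fun t _ => hv t) (fun t ht => htube t (hsubR ht)) h0 (hexp.trans_lt hεA)).trans hexp
  have hzI : z ∈ Icc (-R) R := abs_le.1 hzR
  have huS : u z ∈ S := htube z hzI _ (hdist.trans_lt hεA)
  have hvS : v z ∈ S := htube z hzI _ (by rwa [dist_self])
  have hWopen : IsOpen (Ioo p q ∩ u ⁻¹' U) :=
    ContinuousOn.isOpen_inter_preimage
      (fun t ht => (hu t ht).continuousAt.continuousWithinAt) isOpen_Ioo hU
  have e1 : iteratedDeriv m f z = H (u z) :=
    hHu u _ hWopen (fun t ht => ht.2) (fun t ht => hu t ht.1) z ⟨hzmem, hSU huS⟩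
  have e2 : iteratedDeriv m ftil z = H (v z) :=
    hHu v univ isOpen_univ (fun t _ => hf₀.trans_le (hge t)) (fun t _ => hv t) z (mem_univ z)
  rw [e1, e2, hεlam, ← Real.dist_eq]
  calc dist (H (u z)) (H (v z)) ≤ N * dist (u z) (v z) := hN.dist_le_mul _ huS _ hvS
    _ ≤ N * (ε * A) := by gcongr
    _ ≤ (N * A + 1) * ε := by linarith
end
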